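/- arXiv:2309.00097 — 2 statements merged into one kernel-verified Lean document; each statement's English description precedes it below -/
import Mathlib

section
/- There exists an absolute constant C > 0 such that the following holds. Let t ≥ 2 and n be integers with n ≥ C·t·(log t)². If 𝓕 is a t-intersecting family of partitions of [n], then |𝓕| ≤ B_{n−t}; moreover, equality holds only if 𝓕 is the family of all partitions of [n] that contain t fixed singleton parts {x₁},…,{x_t} (for some t distinct elements x₁,…,x_t of [n]). -/
open scoped Classical

/-- A partition of `[n]` (modeled as `Fin n`): a set of pairwise disjoint nonempty
subsets whose union is everything. -/
def IsPartition {n : ℕ} (P : Finset (Finset (Fin n))) : Prop :=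
  ∅ ∉ P ∧ (∀ p ∈ P, ∀ q ∈ P, p ≠ q → Disjoint p q) ∧ ∀ x : Fin n, ∃ p ∈ P, x ∈ p

/-- The `n`-th Bell number: the number of partitions of `[n]`. -/
noncomputable def bell (n : ℕ) : ℕ :=
  (Finset.univ.filter fun P : Finset (Finset (Fin n)) => IsPartition P).card

open Finset

/-! ### Compression of a finite family by a self-map -/

section Compression

variable {α : Type*} [DecidableEq α]

/-- The map underlying compression: move `a` to `f a` unless `f a` is already in the family. -/
def compressMap (f : α → α) (F : Finset α) (a : α) : α :=
  if f a ∈ F then a else f a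

/-- The compression of the family `F` by `f`. -/
def compress (f : α → α) (F : Finset α) : Finset α :=
  F.image (compressMap f F)

lemma compressMap_injOn {f : α → α} {F : Finset α}
    (hf : ∀ a ∈ F, ∀ b ∈ F, f a ≠ a → f b ≠ b → f a = f b → a = b) :
    Set.InjOn (compressMap f F) F := by
  intro a ha b hb h
  have ha' : a ∈ F := ha
  have hb' : b ∈ F := hb
  unfold compressMap at h
  split_ifs at h with h1 h2 h2
  · exact h
  · exact absurd (h ▸ ha') h2
  · exact absurd (h ▸ hb') h1
  · exact hf a ha b hb (fun e => h1 (by rwa [e])) (fun e => h2 (by rwa [e])) h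

/-- A symmetric relation holding throughout `F` holds throughout its compression as soon as it
can be transported in the two critical configurations. -/
lemma compress_pairwise {f : α → α} {F : Finset α} {r : α → α → Prop}
    (hsymm : ∀ a b, r a b → r b a) (hF : ∀ a ∈ F, ∀ b ∈ F, r a b)
    (hmove : ∀ a ∈ F, ∀ b ∈ F, f a ≠ a → f b ≠ b → r a b → r (f a) (f b))
    (hstay : ∀ a ∈ F, ∀ b ∈ F, f a ≠ a → r a b → r a (f b) → r (f a) b) :
    ∀ a ∈ compress f F, ∀ b ∈ compress f F, r a b := by
  intro a' ha' b' hb'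
  obtain ⟨a, ha, rfl⟩ := mem_image.1 ha'
  obtain ⟨b, hb, rfl⟩ := mem_image.1 hb'
  unfold compressMap
  split_ifs with h1 h2 h2
  · exact hF a ha b hb
  · exact hsymm _ _ (hstay b hb a ha (fun e => h2 (by rwa [e])) (hF b hb a ha) (hF b hb _ h1))
  · exact hstay a ha b hb (fun e => h1 (by rwa [e])) (hF a ha b hb) (hF a ha _ h2)
  · exact hmove a ha b hb (fun e => h1 (by rwa [e])) (fun e => h2 (by rwa [e])) (hF a ha b hb)

lemma sum_compress {f : α → α} {F : Finset α} {M : Type*} [AddCommMonoid M] (g : α → M)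
    (hf : ∀ a ∈ F, ∀ b ∈ F, f a ≠ a → f b ≠ b → f a = f b → a = b) :
    ∑ a ∈ compress f F, g a = ∑ a ∈ F, g (compressMap f F a) :=
  sum_image (compressMap_injOn hf)

lemma card_compress {f : α → α} {F : Finset α}
    (hf : ∀ a ∈ F, ∀ b ∈ F, f a ≠ a → f b ≠ b → f a = f b → a = b) :
    (compress f F).card = F.card :=
  card_image_of_injOn (compressMap_injOn hf)

lemma forall_mem_compress {f : α → α} {F : Finset α} {p : α → Prop} (hp : ∀ a ∈ F, p a)
    (hf : ∀ a, p a → p (f a)) : ∀ a ∈ compress f F, p a := by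
  intro a' ha'
  obtain ⟨a, ha, rfl⟩ := mem_image.1 ha'
  unfold compressMap
  split_ifs
  · exact hp a ha
  · exact hf a (hp a ha)

end Compression

/-! ### Splitting an element off its block -/

namespace IsPartition

variable {n : ℕ} {P Q : Finset (Finset (Fin n))}

lemma eq_of_mem (h : IsPartition P) {p q : Finset (Fin n)} {x : Fin n} (hp : p ∈ P) (hq : q ∈ P)
    (hxp : x ∈ p) (hxq : x ∈ q) : p = q := by
  by_contra hne
  exact (disjoint_left.1 (h.2.1 p hp q hq hne)) hxp hxq

lemma nonempty (h : IsPartition P) {p : Finset (Fin n)} (hp : p ∈ P) : p.Nonempty := by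
  rw [nonempty_iff_ne_empty]
  rintro rfl
  exact h.1 hp

end IsPartition

section Split

variable {n : ℕ} {P Q : Finset (Finset (Fin n))} {x y : Fin n}

/-- `x` and `y` lie in a common block of `P`. -/
def SameBlock (x y : Fin n) (P : Finset (Finset (Fin n))) : Prop :=
  ∃ b ∈ P, x ∈ b ∧ y ∈ b

/-- Make `x` a singleton block, provided that `x` and `y` lie in a common block. -/
noncomputable def splitOff (x y : Fin n) (P : Finset (Finset (Fin n))) :
    Finset (Finset (Fin n)) :=
  if SameBlock x y P then insert {x} (P.image fun b => b.erase x) else P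

lemma splitOff_of_not_sameBlock (h : ¬ SameBlock x y P) : splitOff x y P = P := if_neg h

lemma sameBlock_of_splitOff_ne (h : splitOff x y P ≠ P) : SameBlock x y P := by
  by_contra hj
  exact h (splitOff_of_not_sameBlock hj)

lemma mem_splitOff (hj : SameBlock x y P) {c : Finset (Fin n)} :
    c ∈ splitOff x y P ↔ c = {x} ∨ (c ∈ P ∧ x ∉ c) ∨ ∃ b ∈ P, x ∈ b ∧ c = b.erase x := by
  unfold splitOff
  rw [if_pos hj, mem_insert, mem_image]
  refine or_congr_right ?_
  constructor
  · rintro ⟨b, hb, rfl⟩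
    by_cases hx : x ∈ b
    · exact Or.inr ⟨b, hb, hx, rfl⟩
    · left
      rw [erase_eq_of_notMem hx]
      exact ⟨hb, hx⟩
  · rintro (⟨hc, hx⟩ | ⟨b, hb, hx, rfl⟩)
    · exact ⟨c, hc, erase_eq_of_notMem hx⟩
    · exact ⟨b, hb, rfl⟩

lemma SameBlock.mem_right (hj : SameBlock x y P) (hP : IsPartition P)
    {b : Finset (Fin n)} (hb : b ∈ P) (hx : x ∈ b) : y ∈ b := by
  obtain ⟨c, hc, hxc, hyc⟩ := hj
  rwa [hP.eq_of_mem hb hc hx hxc]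

lemma SameBlock.mem_left (hj : SameBlock x y P) (hP : IsPartition P)
    {b : Finset (Fin n)} (hb : b ∈ P) (hy : y ∈ b) : x ∈ b := by
  obtain ⟨c, hc, hxc, hyc⟩ := hj
  rwa [hP.eq_of_mem hb hc hy hyc]

lemma IsPartition.splitOff (hP : IsPartition P) (hxy : x ≠ y) : IsPartition (splitOff x y P) := by
  by_cases hj : SameBlock x y P
  swap
  · rwa [splitOff_of_not_sameBlock hj]
  refine ⟨?_, ?_, ?_⟩
  · rw [mem_splitOff hj]
    rintro (h | ⟨h, -⟩ | ⟨b, hb, hx, h⟩)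
    · exact singleton_ne_empty x h.symm
    · exact hP.1 h
    · have : y ∈ b.erase x := mem_erase.2 ⟨hxy.symm, hj.mem_right hP hb hx⟩
      rw [← h] at this
      exact notMem_empty _ this
  · intro p hp q hq hpq
    rw [disjoint_left]
    intro z hzp hzq
    apply hpq
    rw [mem_splitOff hj] at hp hq
    have key : ∀ c, (c = {x} ∨ (c ∈ P ∧ x ∉ c) ∨ ∃ b ∈ P, x ∈ b ∧ c = b.erase x) → z ∈ c →
        (z = x ∧ c = {x}) ∨ (z ≠ x ∧ ∃ b ∈ P, z ∈ b ∧ c = b.erase x) := by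
      rintro c (rfl | ⟨hc, hx⟩ | ⟨b, hb, hx, rfl⟩) hz
      · exact Or.inl ⟨mem_singleton.1 hz, rfl⟩
      · exact Or.inr ⟨fun e => hx (e ▸ hz), c, hc, hz, (erase_eq_of_notMem hx).symm⟩
      · exact Or.inr ⟨(mem_erase.1 hz).1, b, hb, (mem_erase.1 hz).2, rfl⟩
    rcases key p hp hzp with ⟨h1, h2⟩ | ⟨h1, b, hb, hzb, h2⟩ <;>
    rcases key q hq hzq with ⟨h3, h4⟩ | ⟨h3, c, hc, hzc, h4⟩
    · rw [h2, h4]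
    · exact absurd h1 h3
    · exact absurd h3 h1
    · rw [h2, h4, hP.eq_of_mem hb hc hzb hzc]
  · intro z
    by_cases hz : z = x
    · exact ⟨{x}, (mem_splitOff hj).2 (Or.inl rfl), by simp [hz]⟩
    · obtain ⟨b, hb, hzb⟩ := hP.2.2 z
      by_cases hx : x ∈ b
      · exact ⟨b.erase x, (mem_splitOff hj).2 (Or.inr (Or.inr ⟨b, hb, hx, rfl⟩)),
          mem_erase.2 ⟨hz, hzb⟩⟩
      · exact ⟨b, (mem_splitOff hj).2 (Or.inr (Or.inl ⟨hb, hx⟩)), hzb⟩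

lemma subset_of_splitOff_eq (hP : IsPartition P) (hQ : IsPartition Q) (hxy : x ≠ y)
    (hjP : SameBlock x y P) (hjQ : SameBlock x y Q) (h : splitOff x y P = splitOff x y Q) :
    P ⊆ Q := by
  intro b hb
  by_cases hx : x ∈ b
  · have hy := hjP.mem_right hP hb hx
    have h1 : b.erase x ∈ splitOff x y Q := by
      rw [← h, mem_splitOff hjP]
      exact Or.inr (Or.inr ⟨b, hb, hx, rfl⟩)
    have hy' : y ∈ b.erase x := mem_erase.2 ⟨hxy.symm, hy⟩
    rcases (mem_splitOff hjQ).1 h1 with h2 | ⟨h2, h3⟩ | ⟨c, hc, hxc, h2⟩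
    · rw [h2, mem_singleton] at hy'
      exact absurd hy'.symm hxy
    · exact absurd (hjQ.mem_left hQ h2 hy') h3
    · have : b = c := by rw [← insert_erase hx, ← insert_erase hxc, h2]
      rwa [this]
  · have hy : y ∉ b := fun hy => hx (hjP.mem_left hP hb hy)
    have h1 : b ∈ splitOff x y Q := by
      rw [← h, mem_splitOff hjP]
      exact Or.inr (Or.inl ⟨hb, hx⟩)
    rcases (mem_splitOff hjQ).1 h1 with h2 | ⟨h2, h3⟩ | ⟨c, hc, hxc, h2⟩
    · rw [h2] at hx
      exact absurd (mem_singleton_self x) hx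
    · exact h2
    · rw [h2] at hy
      exact absurd (mem_erase.2 ⟨hxy.symm, hjQ.mem_right hQ hc hxc⟩) hy

lemma splitOff_injective (hP : IsPartition P) (hQ : IsPartition Q) (hxy : x ≠ y)
    (hP' : splitOff x y P ≠ P) (hQ' : splitOff x y Q ≠ Q) (h : splitOff x y P = splitOff x y Q) :
    P = Q :=
  have hjP := sameBlock_of_splitOff_ne hP'
  have hjQ := sameBlock_of_splitOff_ne hQ'
  Subset.antisymm (subset_of_splitOff_eq hP hQ hxy hjP hjQ h)
    (subset_of_splitOff_eq hQ hP hxy hjQ hjP h.symm)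

lemma mem_splitOff_of_notMem (hj : SameBlock x y P) {c : Finset (Fin n)} (hc : c ∈ P) (hx : x ∉ c) :
    c ∈ splitOff x y P :=
  (mem_splitOff hj).2 (Or.inr (Or.inl ⟨hc, hx⟩))

lemma mem_of_mem_splitOff (hP : IsPartition P) (hxy : x ≠ y) {c : Finset (Fin n)}
    (hc : c ∈ splitOff x y P) (hx : x ∉ c) (hy : y ∉ c) : c ∈ P := by
  by_cases hj : SameBlock x y P
  · rcases (mem_splitOff hj).1 hc with rfl | ⟨h, -⟩ | ⟨b, hb, hxb, rfl⟩
    · exact absurd (mem_singleton_self x) hx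
    · exact h
    · exact absurd (mem_erase.2 ⟨hxy.symm, hj.mem_right hP hb hxb⟩) hy
  · rwa [splitOff_of_not_sameBlock hj] at hc

lemma not_sameBlock_splitOff (hxy : x ≠ y) :
    ¬ SameBlock x y (splitOff x y P) := by
  rintro ⟨c, hc, hx, hy⟩
  by_cases hj : SameBlock x y P
  · rcases (mem_splitOff hj).1 hc with rfl | ⟨-, h⟩ | ⟨b, hb, hxb, rfl⟩
    · exact hxy (mem_singleton.1 hy).symm
    · exact h hx
    · exact notMem_erase x b hx
  · rw [splitOff_of_not_sameBlock hj] at hc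
    exact hj ⟨c, hc, hx, hy⟩

lemma card_inter_splitOff_splitOff (hP : IsPartition P)
    (hjP : SameBlock x y P) (hjQ : SameBlock x y Q) :
    (P ∩ Q).card ≤ (splitOff x y P ∩ splitOff x y Q).card := by
  refine card_le_card_of_injOn (fun b => if x ∈ b then {x} else b) ?_ ?_
  · intro b hb
    obtain ⟨hbP, hbQ⟩ := mem_inter.1 (mem_coe.1 hb)
    simp only [coe_inter, Set.mem_inter_iff, mem_coe]
    split_ifs with hx
    · exact ⟨(mem_splitOff hjP).2 (Or.inl rfl), (mem_splitOff hjQ).2 (Or.inl rfl)⟩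
    · exact ⟨mem_splitOff_of_notMem hjP hbP hx, mem_splitOff_of_notMem hjQ hbQ hx⟩
  · intro b hb c hc h
    have hbP := (mem_inter.1 (mem_coe.1 hb)).1
    have hcP := (mem_inter.1 (mem_coe.1 hc)).1
    dsimp only at h
    split_ifs at h with h1 h2 h2
    · exact hP.eq_of_mem hbP hcP h1 h2
    · exact absurd (h ▸ mem_singleton_self x) h2
    · exact absurd (h ▸ mem_singleton_self x) h1
    · exact h

lemma inter_splitOff_subset (hP : IsPartition P) (hQ : IsPartition Q) (hxy : x ≠ y)
    (hjP : SameBlock x y P) : P ∩ splitOff x y Q ⊆ splitOff x y P ∩ Q := by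
  intro b hb
  obtain ⟨hbP, hbQ⟩ := mem_inter.1 hb
  have hx : x ∉ b := fun hx =>
    not_sameBlock_splitOff hxy ⟨b, hbQ, hx, hjP.mem_right hP hbP hx⟩
  have hy : y ∉ b := fun hy => hx (hjP.mem_left hP hbP hy)
  exact mem_inter.2 ⟨mem_splitOff_of_notMem hjP hbP hx, mem_of_mem_splitOff hQ hxy hbQ hx hy⟩

lemma card_lt_card_splitOff (hP : IsPartition P) (hxy : x ≠ y) (hj : SameBlock x y P) :
    P.card < (splitOff x y P).card := by
  have h1 : {x} ∉ P.image fun b => b.erase x := by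
    intro h
    obtain ⟨b, -, hb⟩ := mem_image.1 h
    exact notMem_erase x b (hb ▸ mem_singleton_self x)
  unfold splitOff
  rw [if_pos hj, card_insert_of_notMem h1, Nat.lt_succ_iff, card_image_of_injOn]
  intro b hb c hc h
  have hne : (b.erase x).Nonempty := by
    by_cases hx : x ∈ b
    · exact ⟨y, mem_erase.2 ⟨hxy.symm, hj.mem_right hP hb hx⟩⟩
    · rw [erase_eq_of_notMem hx]
      exact hP.nonempty hb
  obtain ⟨z, hz⟩ := hne
  have hz' : z ∈ c.erase x := by
    have h' : b.erase x = c.erase x := h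
    rwa [h'] at hz
  exact hP.eq_of_mem hb hc (mem_of_mem_erase hz) (mem_of_mem_erase hz')

/-- Compressing by a split preserves being `t`-intersecting. -/
lemma compress_splitOff_inter {t : ℕ} {F : Finset (Finset (Finset (Fin n)))}
    (hF : ∀ P ∈ F, IsPartition P) (hint : ∀ P ∈ F, ∀ Q ∈ F, t ≤ (P ∩ Q).card) (hxy : x ≠ y) :
    ∀ P ∈ compress (splitOff x y) F, ∀ Q ∈ compress (splitOff x y) F, t ≤ (P ∩ Q).card := by
  refine compress_pairwise (fun P Q h => by rwa [inter_comm]) hint ?_ ?_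
  · intro P hP Q hQ hP' hQ' h
    exact h.trans (card_inter_splitOff_splitOff (hF P hP)
      (sameBlock_of_splitOff_ne hP') (sameBlock_of_splitOff_ne hQ'))
  · intro P hP Q hQ hP' _ h
    exact h.trans (card_le_card
      (inter_splitOff_subset (hF P hP) (hF Q hQ) hxy (sameBlock_of_splitOff_ne hP')))

/-! ### Singletons -/

/-- The elements forming singleton blocks. -/
noncomputable def singletons (P : Finset (Finset (Fin n))) : Finset (Fin n) :=
  univ.filter fun x => {x} ∈ P

@[simp] lemma mem_singletons : x ∈ singletons P ↔ {x} ∈ P := by simp [singletons]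

/-- In a family closed under splitting, common blocks may be taken to be singletons. -/
lemma le_card_singletons_inter {t : ℕ} {F : Finset (Finset (Finset (Fin n)))}
    (hF : ∀ P ∈ F, IsPartition P) (hint : ∀ P ∈ F, ∀ Q ∈ F, t ≤ (P ∩ Q).card)
    (hclosed : ∀ x y, x ≠ y → ∀ P ∈ F, splitOff x y P ∈ F) :
    ∀ P ∈ F, ∀ Q ∈ F, t ≤ (singletons P ∩ singletons Q).card := by
  suffices H : ∀ (m : ℕ), ∀ P ∈ F, ∀ Q ∈ F, (P ∩ Q).card = m →
      t ≤ (singletons P ∩ singletons Q).card from fun P hP Q hQ => H _ P hP Q hQ rfl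
  intro m
  induction m using Nat.strong_induction_on with
  | _ m ih =>
    intro P hP Q hQ hm
    by_cases hB : ∃ B ∈ P ∩ Q, 1 < B.card
    · obtain ⟨B, hB, hcard⟩ := hB
      obtain ⟨hBP, hBQ⟩ := mem_inter.1 hB
      obtain ⟨x, hx, y, hy, hxy⟩ := one_lt_card.1 hcard
      have hj : SameBlock x y P := ⟨B, hBP, hx, hy⟩
      have hxQ : ∀ c ∈ Q, x ∈ c → y ∈ c := fun c hc hxc => by
        rwa [(hF Q hQ).eq_of_mem hc hBQ hxc hx]
      have hyQ : ∀ c ∈ Q, y ∈ c → x ∈ c := fun c hc hyc => by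
        rwa [(hF Q hQ).eq_of_mem hc hBQ hyc hy]
      have hsub : splitOff x y P ∩ Q ⊆ (P ∩ Q).erase B := by
        intro c hc
        obtain ⟨hcP, hcQ⟩ := mem_inter.1 hc
        have hxc : x ∉ c := fun h =>
          not_sameBlock_splitOff hxy ⟨c, hcP, h, hxQ c hcQ h⟩
        have hyc : y ∉ c := fun h => hxc (hyQ c hcQ h)
        refine mem_erase.2 ⟨fun e => hxc (e ▸ hx), mem_inter.2
          ⟨mem_of_mem_splitOff (hF P hP) hxy hcP hxc hyc, hcQ⟩⟩
      have hlt : (splitOff x y P ∩ Q).card < m :=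
        hm ▸ (card_le_card hsub).trans_lt (card_erase_lt_of_mem hB)
      refine (ih _ hlt _ (hclosed x y hxy P hP) Q hQ rfl).trans (card_le_card ?_)
      intro z hz
      rw [mem_inter, mem_singletons, mem_singletons] at hz ⊢
      have := hsub (mem_inter.2 hz)
      exact mem_inter.1 (mem_of_mem_erase this)
    · push Not at hB
      refine (hint P hP Q hQ).trans ?_
      have : P ∩ Q ⊆ (singletons P ∩ singletons Q).image fun x => ({x} : Finset (Fin n)) := by
        intro B hBm
        obtain ⟨hBP, hBQ⟩ := mem_inter.1 hBm
        have h1 : B.card = 1 :=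
          le_antisymm (hB B hBm) (card_pos.2 ((hF P hP).nonempty hBP))
        obtain ⟨x, rfl⟩ := card_eq_one.1 h1
        exact mem_image.2 ⟨x, by simp [hBP, hBQ], rfl⟩
      exact (card_le_card this).trans card_image_le

end Split

/-! ### Counting partitions by their singletons -/

section Counting

variable {n : ℕ}

/-- The partitions of `[n]`. -/
noncomputable def partitions (n : ℕ) : Finset (Finset (Finset (Fin n))) :=
  univ.filter fun P => IsPartition P

@[simp] lemma mem_partitions {P : Finset (Finset (Fin n))} :
    P ∈ partitions n ↔ IsPartition P := by simp [partitions]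

lemma card_partitions (n : ℕ) : (partitions n).card = bell n := rfl

/-- The partitions of `[n]` in which all elements of `T` are singletons. -/
noncomputable def starFamily (T : Finset (Fin n)) : Finset (Finset (Finset (Fin n))) :=
  (partitions n).filter fun P => T ⊆ singletons P

lemma mem_starFamily {T : Finset (Fin n)} {P : Finset (Finset (Fin n))} :
    P ∈ starFamily T ↔ IsPartition P ∧ T ⊆ singletons P := by simp [starFamily]

lemma IsPartition.eq_singleton {P : Finset (Finset (Fin n))} (hP : IsPartition P)
    {b : Finset (Fin n)} {x : Fin n} (hb : b ∈ P) (hx : x ∈ b) (hs : x ∈ singletons P) :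
    b = {x} :=
  hP.eq_of_mem hb (mem_singletons.1 hs) hx (mem_singleton_self x)

/-- Fixing the elements of `T` as singletons leaves a partition of the complement of `T`. -/
lemma card_starFamily (T : Finset (Fin n)) : (starFamily T).card = bell (n - T.card) := by
  have hc : (Tᶜ).card = n - T.card := by rw [card_compl, Fintype.card_fin]
  set e : Fin (n - T.card) ↪ Fin n := (Tᶜ.orderEmbOfFin hc).toEmbedding with he
  have hrange : ∀ x, x ∉ T ↔ ∃ i, e i = x := by
    intro x
    have h : Set.range (Tᶜ.orderEmbOfFin hc) = (Tᶜ : Finset (Fin n)) := range_orderEmbOfFin _ _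
    have h2 : x ∈ Set.range (Tᶜ.orderEmbOfFin hc) ↔ x ∉ T := by rw [h]; simp
    rw [← h2]; rfl
  have heT : ∀ i, e i ∉ T := fun i => (hrange _).2 ⟨i, rfl⟩
  symm
  rw [← card_partitions]
  have hmemi : ∀ (Q : Finset (Finset (Fin (n - T.card)))) (q), q.map e ∈
      Q.image (fun b => b.map e) ∪ T.image (fun x => ({x} : Finset (Fin n))) ↔ q ∈ Q := by
    intro Q q
    rw [mem_union, mem_image, mem_image]
    constructor
    · rintro (⟨b, hb, h⟩ | ⟨x, hx, h⟩)
      · rwa [← map_injective e h]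
      · have : x ∈ q.map e := h ▸ mem_singleton_self x
        obtain ⟨i, -, rfl⟩ := mem_map.1 this
        exact absurd hx (heT i)
    · exact fun h => Or.inl ⟨q, h, rfl⟩
  refine card_bij' (fun Q _ => Q.image (fun b => b.map e) ∪ T.image fun x => {x})
    (fun P _ => univ.filter fun q => q.map e ∈ P) ?_ ?_ ?_ ?_
  · intro Q hQ
    rw [mem_partitions] at hQ
    rw [mem_starFamily]
    refine ⟨⟨?_, ?_, ?_⟩, ?_⟩
    · rw [← map_empty e, hmemi]
      exact hQ.1
    · intro p hp q hq hpq
      rw [mem_union, mem_image, mem_image] at hp hq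
      rcases hp with ⟨b, hb, rfl⟩ | ⟨x, hx, rfl⟩ <;> rcases hq with ⟨c, hc, rfl⟩ | ⟨y, hy, rfl⟩
      · rw [disjoint_map]
        exact hQ.2.1 b hb c hc fun h => hpq (by rw [h])
      · rw [disjoint_singleton_right, mem_map]
        rintro ⟨i, -, rfl⟩
        exact heT i hy
      · rw [disjoint_singleton_left, mem_map]
        rintro ⟨i, -, rfl⟩
        exact heT i hx
      · rw [disjoint_singleton]
        exact fun h => hpq (by rw [h])
    · intro x
      by_cases hx : x ∈ T
      · exact ⟨{x}, mem_union_right _ (mem_image_of_mem _ hx), mem_singleton_self x⟩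
      · obtain ⟨i, rfl⟩ := (hrange x).1 hx
        obtain ⟨b, hb, hib⟩ := hQ.2.2 i
        exact ⟨b.map e, mem_union_left _ (mem_image_of_mem _ hb), mem_map_of_mem e hib⟩
    · intro x hx
      rw [mem_singletons]
      exact mem_union_right _ (mem_image_of_mem _ hx)
  · intro P hP
    rw [mem_starFamily] at hP
    obtain ⟨hP, hT⟩ := hP
    rw [mem_partitions]
    refine ⟨?_, ?_, ?_⟩
    · simpa using hP.1
    · intro p hp q hq hpq
      simp only [mem_filter, mem_univ, true_and] at hp hq
      rw [← disjoint_map e]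
      exact hP.2.1 _ hp _ hq fun h => hpq (map_injective e h)
    · intro i
      obtain ⟨b, hb, hib⟩ := hP.2.2 (e i)
      have hbe : (univ.filter fun j => e j ∈ b).map e = b := by
        ext y
        simp only [mem_map, mem_filter, mem_univ, true_and]
        constructor
        · rintro ⟨j, hj, rfl⟩
          exact hj
        · intro hy
          have hyT : y ∉ T := by
            intro hyT
            have := hP.eq_singleton hb hy (hT hyT)
            rw [this, mem_singleton] at hib
            exact heT i (hib ▸ hyT)
          obtain ⟨j, rfl⟩ := (hrange y).1 hyT
          exact ⟨j, hy, rfl⟩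
      exact ⟨univ.filter fun j => e j ∈ b, by simpa [hbe] using hb, by simpa using hib⟩
  · intro Q hQ
    ext q
    rw [mem_filter, hmemi]
    simp
  · intro P hP
    rw [mem_starFamily] at hP
    obtain ⟨hP, hT⟩ := hP
    ext b
    simp only [mem_union, mem_image, mem_filter, mem_univ, true_and]
    constructor
    · rintro (⟨q, hq, rfl⟩ | ⟨x, hx, rfl⟩)
      · exact hq
      · exact mem_singletons.1 (hT hx)
    · intro hb
      by_cases h : ∃ x ∈ b, x ∈ T
      · obtain ⟨x, hxb, hxT⟩ := h
        exact Or.inr ⟨x, hxT, (hP.eq_singleton hb hxb (hT hxT)).symm⟩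
      · push Not at h
        have hbe : (univ.filter fun j => e j ∈ b).map e = b := by
          ext y
          simp only [mem_map, mem_filter, mem_univ, true_and]
          constructor
          · rintro ⟨j, hj, rfl⟩
            exact hj
          · intro hy
            obtain ⟨j, rfl⟩ := (hrange y).1 (h y hy)
            exact ⟨j, hy, rfl⟩
        exact Or.inl ⟨_, hbe.symm ▸ hb, hbe⟩

/-- The number of partitions whose set of singletons is exactly `S`. -/
noncomputable def singletonCount (S : Finset (Fin n)) : ℕ :=
  ((partitions n).filter fun P => singletons P = S).card

lemma isPartition_image_map {P : Finset (Finset (Fin n))} (hP : IsPartition P)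
    (e : Fin n ≃ Fin n) : IsPartition (P.image fun b => b.map e.toEmbedding) := by
  refine ⟨?_, ?_, ?_⟩
  · intro h
    obtain ⟨b, hb, h⟩ := mem_image.1 h
    rw [map_eq_empty] at h
    exact hP.1 (h ▸ hb)
  · intro p hp q hq hpq
    obtain ⟨b, hb, rfl⟩ := mem_image.1 hp
    obtain ⟨c, hc, rfl⟩ := mem_image.1 hq
    rw [disjoint_map]
    exact hP.2.1 b hb c hc fun h => hpq (by rw [h])
  · intro x
    obtain ⟨b, hb, hx⟩ := hP.2.2 (e.symm x)
    exact ⟨_, mem_image_of_mem _ hb, by simpa [mem_map_equiv] using hx⟩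

lemma singletons_image_map (P : Finset (Finset (Fin n))) (e : Fin n ≃ Fin n) :
    singletons (P.image fun b => b.map e.toEmbedding) = (singletons P).map e.toEmbedding := by
  ext x
  rw [mem_map_equiv, mem_singletons, mem_singletons, mem_image]
  constructor
  · rintro ⟨b, hb, h⟩
    have : b = {e.symm x} := map_injective e.toEmbedding (by simpa using h)
    rwa [← this]
  · exact fun h => ⟨_, h, by simp⟩

lemma singletonCount_le_map (S : Finset (Fin n)) (e : Fin n ≃ Fin n) :
    singletonCount S ≤ singletonCount (S.map e.toEmbedding) := by
  refine card_le_card_of_injOn (fun P => P.image fun b => b.map e.toEmbedding) ?_ ?_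
  · intro P hP
    simp only [coe_filter, mem_partitions, Set.mem_ofPred_eq] at hP ⊢
    exact ⟨isPartition_image_map hP.1 e, by rw [singletons_image_map, hP.2]⟩
  · intro P _ Q _ h
    exact image_injective (map_injective e.toEmbedding) h

lemma singletonCount_map (S : Finset (Fin n)) (e : Fin n ≃ Fin n) :
    singletonCount (S.map e.toEmbedding) = singletonCount S := by
  refine le_antisymm ?_ (singletonCount_le_map S e)
  refine (singletonCount_le_map _ e.symm).trans_eq ?_
  congr 1
  ext x
  simp [mem_map_equiv]

/-- Collapsing all singletons outside `T` into one block shows that many partitions have exactly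
`T` as set of singletons. -/
lemma card_starFamily_le_singletonCount {T : Finset (Fin n)} {u v : Fin n} (hu : u ∉ T) (hv : v ∉ T)
    (huv : u ≠ v) : (starFamily (insert u (insert v T))).card ≤ singletonCount T := by
  have hmem : ∀ (P : Finset (Finset (Fin n))) (c : Finset (Fin n)),
      c ∈ insert (singletons P \ T) (P.filter fun b => ∀ x ∈ singletons P \ T, b ≠ {x}) ↔
      c = singletons P \ T ∨ (c ∈ P ∧ ∀ x ∈ singletons P \ T, c ≠ {x}) := by
    intro P c
    rw [mem_insert, mem_filter]
  have huP : ∀ P ∈ starFamily (insert u (insert v T)),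
      u ∈ singletons P \ T ∧ v ∈ singletons P \ T := by
    intro P hP
    have := (mem_starFamily.1 hP).2
    exact ⟨mem_sdiff.2 ⟨this (by simp), hu⟩, mem_sdiff.2 ⟨this (by simp), hv⟩⟩
  have hdisj : ∀ P, IsPartition P → ∀ c ∈ P, (∀ x ∈ singletons P \ T, c ≠ {x}) →
      ∀ x ∈ c, x ∉ singletons P \ T := by
    intro P hP c hc h x hx hxU
    exact h x hxU (hP.eq_singleton hc hx (mem_sdiff.1 hxU).1)
  refine card_le_card_of_injOn (fun P => insert (singletons P \ T)
    (P.filter fun b => ∀ x ∈ singletons P \ T, b ≠ {x})) ?_ ?_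
  · intro P hPs
    obtain ⟨huU, hvU⟩ := huP P hPs
    obtain ⟨hP, hTP⟩ := mem_starFamily.1 hPs
    rw [mem_coe, mem_filter, mem_partitions]
    refine ⟨⟨?_, ?_, ?_⟩, ?_⟩
    · rw [hmem]
      rintro (h | ⟨h, -⟩)
      · rw [← h] at huU
        exact notMem_empty _ huU
      · exact hP.1 h
    · intro p hp q hq hpq
      rw [hmem] at hp hq
      rcases hp with rfl | ⟨hp, hp'⟩ <;> rcases hq with rfl | ⟨hq, hq'⟩
      · exact absurd rfl hpq
      · rw [disjoint_right]
        exact hdisj P hP q hq hq'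
      · rw [disjoint_left]
        exact hdisj P hP p hp hp'
      · exact hP.2.1 p hp q hq hpq
    · intro x
      by_cases hx : x ∈ singletons P \ T
      · exact ⟨_, (hmem P _).2 (Or.inl rfl), hx⟩
      · obtain ⟨b, hb, hxb⟩ := hP.2.2 x
        refine ⟨b, (hmem P _).2 (Or.inr ⟨hb, fun y hy h => ?_⟩), hxb⟩
        rw [h, mem_singleton] at hxb
        exact hx (hxb ▸ hy)
    · ext x
      rw [mem_singletons, hmem]
      constructor
      · rintro (h | ⟨h, h'⟩)
        · rw [← h, mem_singleton] at huU hvU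
          exact absurd (huU.trans hvU.symm) huv
        · by_contra hx
          exact h' x (mem_sdiff.2 ⟨mem_singletons.2 h, hx⟩) rfl
      · intro hx
        have hx' : x ∈ singletons P := hTP (by simp [hx])
        refine Or.inr ⟨mem_singletons.1 hx', fun y hy h => ?_⟩
        rw [singleton_inj] at h
        exact (mem_sdiff.1 hy).2 (h ▸ hx)
  · intro P hPs Q hQs h
    have hPs' : P ∈ starFamily (insert u (insert v T)) := hPs
    have hQs' : Q ∈ starFamily (insert u (insert v T)) := hQs
    dsimp only at h
    have hext : ∀ c, _ ↔ _ := Finset.ext_iff.1 h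
    simp only [hmem] at hext
    have hU : singletons P \ T = singletons Q \ T := by
      rcases (hext _).1 (Or.inl rfl) with h | ⟨h, h'⟩
      · exact h
      · exact absurd (huP Q hQs').1 (hdisj Q (mem_starFamily.1 hQs').1 _ h h' u (huP P hPs').1)
    have key : ∀ P Q, P ∈ starFamily (insert u (insert v T)) →
        Q ∈ starFamily (insert u (insert v T)) →
        singletons P \ T = singletons Q \ T →
        (∀ c, (c = singletons P \ T ∨ (c ∈ P ∧ ∀ x ∈ singletons P \ T, c ≠ {x})) →
          (c = singletons Q \ T ∨ (c ∈ Q ∧ ∀ x ∈ singletons Q \ T, c ≠ {x}))) → P ⊆ Q := by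
      intro P Q hP hQ hU h c hc
      by_cases hcx : ∃ x ∈ singletons P \ T, c = {x}
      · obtain ⟨x, hx, rfl⟩ := hcx
        rw [hU] at hx
        exact mem_singletons.1 (mem_sdiff.1 hx).1
      · push Not at hcx
        rcases h c (Or.inr ⟨hc, hcx⟩) with h | h
        · rw [← hU] at h
          exact absurd (huP P hP).1
            (hdisj P (mem_starFamily.1 hP).1 c hc hcx u (h ▸ (huP P hP).1))
        · exact h.1
    exact Subset.antisymm (key P Q hPs' hQs' hU fun c => (hext c).1)
      (key Q P hQs' hPs' hU.symm fun c => (hext c).2)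

end Counting

/-! ### Growth of the Bell numbers -/

section Growth

variable {n : ℕ}

/-- The partition into the nonempty fibres of `f`. -/
noncomputable def fibers {β : Type*} (f : Fin n → β) : Finset (Finset (Fin n)) :=
  univ.image fun x => univ.filter fun y => f y = f x

lemma mem_fibers {β : Type*} {f : Fin n → β} {b : Finset (Fin n)} :
    b ∈ fibers f ↔ ∃ x, ∀ y, y ∈ b ↔ f y = f x := by
  simp only [fibers, mem_image, mem_univ, true_and, Finset.ext_iff, mem_filter]
  exact exists_congr fun x => forall_congr' fun y => Iff.comm

lemma isPartition_fibers {β : Type*} (f : Fin n → β) : IsPartition (fibers f) := by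
  refine ⟨?_, ?_, fun x => ⟨_, mem_image_of_mem _ (mem_univ x), by simp⟩⟩
  · intro h
    obtain ⟨x, hx⟩ := mem_fibers.1 h
    exact notMem_empty x ((hx x).2 rfl)
  · intro p hp q hq hpq
    obtain ⟨x, hx⟩ := mem_fibers.1 hp
    obtain ⟨y, hy⟩ := mem_fibers.1 hq
    rw [disjoint_left]
    intro z hz hz'
    refine hpq (Finset.ext fun w => ?_)
    rw [hx, hy, ← (hx z).1 hz, ← (hy z).1 hz']

lemma fibers_eq_iff {β : Type*} {f : Fin n → β} {x y : Fin n} :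
    (∃ b ∈ fibers f, x ∈ b ∧ y ∈ b) ↔ f x = f y := by
  constructor
  · rintro ⟨b, hb, hx, hy⟩
    obtain ⟨z, hz⟩ := mem_fibers.1 hb
    rw [(hz x).1 hx, (hz y).1 hy]
  · exact fun h => ⟨_, mem_image_of_mem _ (mem_univ x), by simp, by simp [h]⟩

lemma card_partitions_card_le (n k : ℕ) :
    ((partitions n).filter fun P => P.card ≤ k).card ≤ k ^ n := by
  have h1 : (univ : Finset (Fin n → Fin k)).card = k ^ n := by simp
  rw [← h1]
  refine card_le_card_of_surjOn fibers ?_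
  intro P hP
  rw [mem_coe, mem_filter, mem_partitions] at hP
  obtain ⟨hP, hk⟩ := hP
  have hemb : Nonempty (P ↪ Fin k) := by
    rw [Function.Embedding.nonempty_iff_card_le]
    simpa using hk
  obtain ⟨e⟩ := hemb
  choose b hb hxb using hP.2.2
  have hfib : ∀ x y, y ∈ b x ↔ e ⟨b y, hb y⟩ = e ⟨b x, hb x⟩ := by
    intro x y
    rw [EmbeddingLike.apply_eq_iff_eq, Subtype.mk.injEq]
    constructor
    · exact fun h => hP.eq_of_mem (hb y) (hb x) (hxb y) h
    · intro h
      rw [← h]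
      exact hxb y
  refine ⟨fun x => e ⟨b x, hb x⟩, by simp, ?_⟩
  ext c
  rw [mem_fibers]
  constructor
  · rintro ⟨x, hx⟩
    have : c = b x := Finset.ext fun y => (hx y).trans (hfib x y).symm
    exact this ▸ hb x
  · intro hc
    obtain ⟨x, hx⟩ := hP.nonempty hc
    rw [← hP.eq_of_mem (hb x) hc (hxb x) hx]
    exact ⟨x, hfib x⟩

lemma pow_le_bell (K M : ℕ) : K ^ M ≤ bell (K + M) := by
  have h1 : (univ : Finset (Fin M → Fin K)).card = K ^ M := by simp
  rw [← h1, ← card_partitions]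
  refine card_le_card_of_injOn (fun g => fibers (Fin.append id g)) ?_ ?_
  · intro g _
    rw [mem_coe, mem_partitions]
    exact isPartition_fibers _
  · intro g _ g' _ h
    have h' : fibers (Fin.append id g) = fibers (Fin.append id g') := h
    funext i
    have h2 : Fin.append id g (Fin.castAdd M (g i)) = Fin.append id g (Fin.natAdd K i) := by
      simp
    rw [← fibers_eq_iff, h', fibers_eq_iff] at h2
    simpa using h2

/-- Every non-singleton block can absorb a given singleton. -/
lemma sum_card_erase_le_bell (x : Fin n) (A : Finset (Finset (Finset (Fin n))))
    (hA : A ⊆ starFamily {x}) : ∑ P ∈ A, (P.card - 1) ≤ bell n := by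
  have hA' : ∀ P ∈ A, IsPartition P ∧ {x} ∈ P := fun P hP => by
    simpa [mem_starFamily] using hA hP
  have hcard : ∑ P ∈ A, (P.card - 1) = (A.sigma fun P => P.erase {x}).card := by
    rw [card_sigma]
    exact sum_congr rfl fun P hP => (card_erase_of_mem (hA' P hP).2).symm
  have hnot : ∀ P ∈ A, ∀ b ∈ P.erase {x}, x ∉ b := by
    intro P hP b hb hx
    exact (mem_erase.1 hb).1 ((hA' P hP).1.eq_of_mem (mem_erase.1 hb).2 (hA' P hP).2 hx
      (mem_singleton_self x))
  rw [hcard, ← card_partitions]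
  have hpart : ∀ P ∈ A, ∀ b ∈ P.erase {x},
      IsPartition (insert (insert x b) ((P.erase {x}).erase b)) := by
    intro P hPA b hb
    obtain ⟨hP, hx⟩ := hA' P hPA
    have hbP := (mem_erase.1 hb).2
    have hdis : ∀ q ∈ (P.erase {x}).erase b, Disjoint (insert x b) q := by
      intro q hq
      have hq' := mem_of_mem_erase hq
      rw [disjoint_insert_left]
      exact ⟨hnot P hPA q hq', hP.2.1 b hbP q (mem_of_mem_erase hq') (mem_erase.1 hq).1.symm⟩
    refine ⟨?_, ?_, ?_⟩
    · rw [mem_insert]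
      rintro (h | h)
      · exact insert_ne_empty x b h.symm
      · exact hP.1 (mem_of_mem_erase (mem_of_mem_erase h))
    · intro p hp q hq hpq
      rw [mem_insert] at hp hq
      rcases hp with rfl | hp <;> rcases hq with rfl | hq
      · exact absurd rfl hpq
      · exact hdis q hq
      · exact (hdis p hp).symm
      · exact hP.2.1 p (mem_of_mem_erase (mem_of_mem_erase hp)) q
          (mem_of_mem_erase (mem_of_mem_erase hq)) hpq
    · intro y
      by_cases hy : y ∈ insert x b
      · exact ⟨_, mem_insert_self _ _, hy⟩
      · rw [mem_insert, not_or] at hy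
        obtain ⟨c, hc, hyc⟩ := hP.2.2 y
        refine ⟨c, mem_insert_of_mem (mem_erase.2 ⟨fun h => hy.2 (h ▸ hyc), mem_erase.2
          ⟨fun h => hy.1 ?_, hc⟩⟩), hyc⟩
        rw [h] at hyc
        exact mem_singleton.1 hyc
  refine card_le_card_of_injOn
    (fun s => insert (insert x s.2) ((s.1.erase {x}).erase s.2)) ?_ ?_
  · rintro ⟨P, b⟩ hs
    rw [mem_coe, mem_sigma] at hs
    rw [mem_coe, mem_partitions]
    exact hpart P hs.1 b hs.2
  · rintro ⟨P, b⟩ hs ⟨Q, c⟩ hs' h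
    rw [mem_coe, mem_sigma] at hs hs'
    obtain ⟨hP, hb⟩ := hs
    obtain ⟨hQ, hc⟩ := hs'
    dsimp only at hP hb hQ hc h
    have hbc : insert x b = insert x c :=
      (hpart Q hQ c hc).eq_of_mem (h ▸ mem_insert_self _ _) (mem_insert_self _ _)
        (mem_insert_self x b) (mem_insert_self x c)
    have hbc' : b = c := by
      rw [← erase_insert (hnot P hP b hb), hbc, erase_insert (hnot Q hQ c hc)]
    subst hbc'
    have hn : ∀ P ∈ A, insert x b ∉ (P.erase {x}).erase b := fun P hP h =>
      hnot P hP _ (mem_of_mem_erase h) (mem_insert_self x b)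
    have h1 : (P.erase {x}).erase b = (Q.erase {x}).erase b := by
      rw [← erase_insert (hn P hP), h, erase_insert (hn Q hQ)]
    have h2 : P.erase {x} = Q.erase {x} := by
      rw [← insert_erase hb, h1, insert_erase hc]
    have h3 : P = Q := by
      rw [← insert_erase (hA' P hP).2, h2, insert_erase (hA' Q hQ).2]
    subst h3
    rfl

lemma mul_bell_le_bell_succ {R N : ℕ} (hR : 1 ≤ R) (hN : 8 * R ≤ N)
    (h : (8 * R) ^ (2 * (8 * R)) ≤ 2 ^ N) : R * bell N ≤ bell (N + 1) := by
  have hfew : 2 * (2 * R) ^ (N + 1) ≤ bell N := by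
    obtain ⟨M, rfl⟩ := Nat.exists_eq_add_of_le hN
    refine le_trans ?_ (pow_le_bell (8 * R) M)
    have hpos : 0 < (8 * R) ^ (8 * R) := by positivity
    refine Nat.le_of_mul_le_mul_left ?_ hpos
    rw [← pow_add]
    set N := 8 * R + M
    have h1 : (8 * R) ^ N = 2 ^ N * 2 ^ N * (2 * R) ^ N := by
      rw [← mul_pow, ← mul_pow]
      congr 1
      ring
    have h2 : (8 * R) ^ (8 * R) * (8 * R) ≤ 2 ^ N := by
      refine le_trans ?_ h
      rw [← pow_succ]
      exact Nat.pow_le_pow_right (by omega) (by omega)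
    have h3 : 1 ≤ 2 ^ N := Nat.one_le_two_pow
    calc (8 * R) ^ (8 * R) * (2 * (2 * R) ^ (N + 1))
        = ((8 * R) ^ (8 * R) * (4 * R)) * (2 * R) ^ N := by ring
      _ ≤ ((8 * R) ^ (8 * R) * (8 * R)) * (2 * R) ^ N := by gcongr; omega
      _ ≤ (2 ^ N * 2 ^ N) * (2 * R) ^ N := by
          refine Nat.mul_le_mul_right _ (h2.trans ?_)
          exact Nat.le_mul_of_pos_left _ h3
      _ = (8 * R) ^ N := h1.symm
  have hstar : (starFamily {(0 : Fin (N + 1))}).card = bell N := by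
    rw [card_starFamily, card_singleton, Nat.add_sub_cancel]
  set A := (starFamily {(0 : Fin (N + 1))}).filter fun P => ¬ P.card ≤ 2 * R with hA
  have hsplit : ((starFamily {(0 : Fin (N + 1))}).filter fun P => P.card ≤ 2 * R).card + A.card =
      bell N := by
    rw [← hstar]
    exact card_filter_add_card_filter_not _
  have hsmall : ((starFamily {(0 : Fin (N + 1))}).filter fun P => P.card ≤ 2 * R).card ≤
      (2 * R) ^ (N + 1) := by
    refine le_trans (card_le_card ?_) (card_partitions_card_le (N + 1) (2 * R))
    intro P hP
    rw [mem_filter, mem_starFamily] at hP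
    rw [mem_filter, mem_partitions]
    exact ⟨hP.1.1, hP.2⟩
  have hsum : A.card * (2 * R) ≤ bell (N + 1) := by
    refine le_trans ?_ (sum_card_erase_le_bell 0 A (filter_subset _ _))
    rw [← smul_eq_mul]
    refine card_nsmul_le_sum _ _ _ fun P hP => ?_
    have := (mem_filter.1 hP).2
    omega
  nlinarith

end Growth

/-! ### Shifting families of subsets -/

section Shift

variable {n : ℕ} {S T A B : Finset (Fin n)} {i j : Fin n}

/-- Replace `j` by `i` if possible. -/
def shift (i j : Fin n) (S : Finset (Fin n)) : Finset (Fin n) :=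
  if j ∈ S ∧ i ∉ S then insert i (S.erase j) else S

lemma shift_of_mem (hj : j ∈ S) (hi : i ∉ S) : shift i j S = insert i (S.erase j) :=
  if_pos ⟨hj, hi⟩

lemma mem_of_shift_ne (h : shift i j S ≠ S) : j ∈ S ∧ i ∉ S := by
  by_contra hn
  exact h (if_neg hn)

lemma shift_injective (hS : shift i j S ≠ S) (hT : shift i j T ≠ T)
    (h : shift i j S = shift i j T) : S = T := by
  obtain ⟨hjS, hiS⟩ := mem_of_shift_ne hS
  obtain ⟨hjT, hiT⟩ := mem_of_shift_ne hT
  rw [shift_of_mem hjS hiS, shift_of_mem hjT hiT] at h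
  have h1 : S.erase j = T.erase j := by
    rw [← erase_insert (fun h => hiS (mem_of_mem_erase h)), h,
      erase_insert (fun h => hiT (mem_of_mem_erase h))]
  rw [← insert_erase hjS, h1, insert_erase hjT]

lemma card_shift (i j : Fin n) (S : Finset (Fin n)) : (shift i j S).card = S.card := by
  unfold shift
  split_ifs with h
  · rw [card_insert_of_notMem (fun h' => h.2 (mem_of_mem_erase h')), card_erase_add_one h.1]
  · rfl

lemma singletonCount_shift (i j : Fin n) (S : Finset (Fin n)) :
    singletonCount (shift i j S) = singletonCount S := by
  by_cases h : j ∈ S ∧ i ∉ S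
  · rw [shift_of_mem h.1 h.2, ← singletonCount_map S (Equiv.swap i j)]
    congr 1
    ext x
    have hij : i ≠ j := fun e => h.2 (e ▸ h.1)
    rw [mem_map_equiv, Equiv.symm_swap, mem_insert, mem_erase]
    by_cases hxi : x = i
    · simp [hxi, h.1]
    · by_cases hxj : x = j
      · simp [hxj, h.2, hij.symm]
      · simp [Equiv.swap_apply_of_ne_of_ne hxi hxj, hxi, hxj]
  · unfold shift
    rw [if_neg h]

/-- Compressing by a shift preserves being `t`-intersecting. -/
lemma compress_shift_inter {t : ℕ} {𝒮 : Finset (Finset (Fin n))}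
    (hint : ∀ A ∈ 𝒮, ∀ B ∈ 𝒮, t ≤ (A ∩ B).card) :
    ∀ A ∈ compress (shift i j) 𝒮, ∀ B ∈ compress (shift i j) 𝒮, t ≤ (A ∩ B).card := by
  refine compress_pairwise (fun P Q h => by rwa [inter_comm]) hint ?_ ?_
  · intro A _ B _ hA hB h
    obtain ⟨hjA, hiA⟩ := mem_of_shift_ne hA
    obtain ⟨hjB, hiB⟩ := mem_of_shift_ne hB
    have heq : insert i (A.erase j) ∩ insert i (B.erase j) = shift i j (A ∩ B) := by
      rw [shift_of_mem (mem_inter.2 ⟨hjA, hjB⟩) fun h => hiA (mem_inter.1 h).1]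
      ext x
      simp only [mem_inter, mem_insert, mem_erase]
      tauto
    rwa [shift_of_mem hjA hiA, shift_of_mem hjB hiB, heq, card_shift]
  · intro A _ B _ hA h h'
    obtain ⟨hjA, hiA⟩ := mem_of_shift_ne hA
    rw [shift_of_mem hjA hiA]
    by_cases hjB : j ∈ B
    · by_cases hiB : i ∈ B
      · have heq : insert i (A.erase j) ∩ B = shift i j (A ∩ B) := by
          rw [shift_of_mem (mem_inter.2 ⟨hjA, hjB⟩) fun h => hiA (mem_inter.1 h).1]
          ext x
          simp only [mem_inter, mem_insert, mem_erase]
          constructor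
          · tauto
          · rintro (rfl | h)
            · exact ⟨Or.inl rfl, hiB⟩
            · tauto
        rwa [heq, card_shift]
      · refine h'.trans (card_le_card fun x hx => ?_)
        rw [shift_of_mem hjB hiB, mem_inter, mem_insert, mem_erase] at hx
        rw [mem_inter, mem_insert, mem_erase]
        rcases hx with ⟨hxA, rfl | ⟨hxj, hxB⟩⟩
        · exact absurd hxA hiA
        · exact ⟨Or.inr ⟨hxj, hxA⟩, hxB⟩
    · refine h.trans (card_le_card fun x hx => ?_)
      rw [mem_inter] at hx
      rw [mem_inter, mem_insert, mem_erase]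
      exact ⟨Or.inr ⟨fun e => hjB (e ▸ hx.2), hx.1⟩, hx.2⟩

/-- The elements of `S` among the first `k` elements of `[n]`. -/
def initialPart (S : Finset (Fin n)) (k : ℕ) : Finset (Fin n) := S.filter fun x => x.val < k

lemma mem_initialPart {k : ℕ} {x : Fin n} : x ∈ initialPart S k ↔ x ∈ S ∧ x.val < k := by
  simp [initialPart]

lemma card_initialPart_univ {k : ℕ} (hk : k ≤ n) :
    (initialPart (univ : Finset (Fin n)) k).card = k := by
  simp [initialPart, Fin.card_filter_val_lt, hk]

lemma initialPart_mono {k l : ℕ} (hST : S ⊆ T) (hkl : k ≤ l) :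
    initialPart S k ⊆ initialPart T l := fun x hx => by
  rw [mem_initialPart] at hx ⊢
  exact ⟨hST hx.1, hx.2.trans_le hkl⟩

lemma card_initialPart_le {k : ℕ} (hk : k ≤ n) : (initialPart S k).card ≤ k :=
  (card_le_card (initialPart_mono (subset_univ S) le_rfl)).trans_eq (card_initialPart_univ hk)

lemma initialPart_succ_subset (S : Finset (Fin n)) (k : Fin n) :
    initialPart S (k + 1) ⊆ insert k (initialPart S k) := by
  intro x hx
  rw [mem_initialPart] at hx
  rw [mem_insert, mem_initialPart, Fin.ext_iff]
  rcases Nat.lt_succ_iff_lt_or_eq.1 hx.2 with h | h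
  · exact Or.inr ⟨hx.1, h⟩
  · exact Or.inl h

lemma initialPart_of_le {k : ℕ} (hk : n ≤ k) : initialPart S k = S :=
  filter_true_of_mem fun x _ => x.2.trans_le hk

lemma card_initialPart_add (A B : Finset (Fin n)) (k : ℕ) :
    (initialPart A k).card + (initialPart B k).card =
      (initialPart (A ∪ B) k).card + (initialPart (A ∩ B) k).card := by
  unfold initialPart
  rw [filter_union, filter_inter_distrib, card_union_add_card_inter]

/-- The walk lemma of Frankl for two members of a shifted `t`-intersecting family. -/
lemma exists_card_initialPart_add_ge {t : ℕ} {𝒮 : Finset (Finset (Fin n))}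
    (hint : ∀ A ∈ 𝒮, ∀ B ∈ 𝒮, t ≤ (A ∩ B).card)
    (hshift : ∀ i j, i < j → ∀ S ∈ 𝒮, shift i j S ∈ 𝒮) (hA : A ∈ 𝒮) (hB : B ∈ 𝒮) :
    ∃ k ≤ n, k + t ≤ (initialPart A k).card + (initialPart B k).card := by
  suffices H : ∀ m : ℕ, ∀ B ∈ 𝒮, ∑ x ∈ B, x.val = m →
      ∃ k ≤ n, k + t ≤ (initialPart A k).card + (initialPart B k).card from H _ B hB rfl
  intro m
  induction m using Nat.strong_induction_on with
  | _ m ih =>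
    intro B hB hm
    by_contra! hcon
    have hex : ∃ k, t ≤ (initialPart (A ∩ B) k).card :=
      ⟨n, by rw [initialPart_of_le le_rfl]; exact hint A hA B hB⟩
    obtain ⟨k₀, hk₀, hmin⟩ : ∃ k, t ≤ (initialPart (A ∩ B) k).card ∧
        ∀ l < k, (initialPart (A ∩ B) l).card < t :=
      ⟨Nat.find hex, Nat.find_spec hex, fun l hl => not_le.1 (Nat.find_min hex hl)⟩
    have hk₀n : k₀ ≤ n := by
      by_contra h
      have := hmin n (not_le.1 h)
      rw [initialPart_of_le le_rfl] at this
      exact absurd (hint A hA B hB) (not_le.2 this)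
    rcases Nat.eq_zero_or_pos k₀ with h0 | hpos
    · subst h0
      have := hcon 0 (Nat.zero_le _)
      simp [initialPart] at this hk₀
      omega
    obtain ⟨k, rfl⟩ : ∃ k : Fin n, k₀ = k + 1 := ⟨⟨k₀ - 1, by omega⟩, by simp; omega⟩
    have hlt := hmin k (Nat.lt_succ_self _)
    have hkAB : k ∈ A ∩ B := by
      by_contra hk
      have : initialPart (A ∩ B) (k + 1) ⊆ initialPart (A ∩ B) k := by
        intro x hx
        rcases mem_insert.1 (initialPart_succ_subset _ k hx) with rfl | h
        · exact absurd (mem_initialPart.1 hx).1 hk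
        · exact h
      exact absurd (card_le_card this) (by omega)
    obtain ⟨hkA, hkB⟩ := mem_inter.1 hkAB
    have hfree : ∃ j : Fin n, j.val < k + 1 ∧ j ∉ A ∪ B := by
      by_contra! h
      have hsub : initialPart univ (k + 1) ⊆ initialPart (A ∪ B) (k + 1) := fun x hx =>
        mem_initialPart.2 ⟨h x (mem_initialPart.1 hx).2, (mem_initialPart.1 hx).2⟩
      have h1 := card_le_card hsub
      rw [card_initialPart_univ hk₀n] at h1
      have h2 := hcon _ hk₀n
      rw [card_initialPart_add] at h2
      omega
    obtain ⟨j, hjk, hjAB⟩ := hfree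
    rw [mem_union, not_or] at hjAB
    obtain ⟨hjA, hjB⟩ := hjAB
    have hjk' : j < k := by
      have : j ≠ k := fun e => hjA (e ▸ hkA)
      rw [Fin.lt_def]
      rw [Ne, Fin.ext_iff] at this
      omega
    have hB' := hshift j k hjk' B hB
    rw [shift_of_mem hkB hjB] at hB'
    have hjB' : j ∉ B.erase k := fun h => hjB (mem_of_mem_erase h)
    have hsum : ∑ x ∈ insert j (B.erase k), x.val < m := by
      rw [sum_insert hjB', ← hm, ← add_sum_erase B (fun x => x.val) hkB]
      exact Nat.add_lt_add_right hjk' _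
    obtain ⟨l, hl, hle⟩ := ih _ hsum _ hB' rfl
    have hconl := hcon l hl
    by_cases hlj : l ≤ j
    · have : initialPart (insert j (B.erase k)) l ⊆ initialPart B l := by
        intro x hx
        rw [mem_initialPart, mem_insert, mem_erase] at hx
        rw [mem_initialPart]
        rcases hx with ⟨rfl | hx, hxl⟩
        · omega
        · exact ⟨hx.2, hxl⟩
      have := card_le_card this
      omega
    by_cases hlk : l ≤ k
    · rw [card_initialPart_add] at hle
      have h1 : initialPart (A ∩ insert j (B.erase k)) l ⊆ initialPart (A ∩ B) k := by
        refine initialPart_mono ?_ hlk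
        intro x hx
        rw [mem_inter, mem_insert, mem_erase] at hx
        rcases hx with ⟨hxA, rfl | hx⟩
        · exact absurd hxA hjA
        · exact mem_inter.2 ⟨hxA, hx.2⟩
      have h2 := card_le_card h1
      have h3 := card_initialPart_le (S := A ∪ insert j (B.erase k)) hl
      omega
    · have h1 : initialPart (insert j (B.erase k)) l ⊆ shift j k (initialPart B l) := by
        rw [shift_of_mem (mem_initialPart.2 ⟨hkB, by omega⟩)
          (fun h => hjB (mem_initialPart.1 h).1)]
        intro x hx
        rw [mem_initialPart, mem_insert, mem_erase] at hx
        rw [mem_insert, mem_erase, mem_initialPart]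
        tauto
      have h2 := card_le_card h1
      rw [card_shift] at h2
      omega

lemma exists_card_initialPart_ge {t : ℕ} {𝒮 : Finset (Finset (Fin n))}
    (hint : ∀ A ∈ 𝒮, ∀ B ∈ 𝒮, t ≤ (A ∩ B).card)
    (hshift : ∀ i j, i < j → ∀ S ∈ 𝒮, shift i j S ∈ 𝒮) (hS : S ∈ 𝒮) :
    ∃ l, t + 2 * l ≤ n ∧ t + l ≤ (initialPart S (t + 2 * l)).card := by
  obtain ⟨k, hk, h⟩ := exists_card_initialPart_add_ge hint hshift hS hS
  have hle := card_initialPart_le (S := S) hk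
  rcases Nat.even_or_odd' (k - t) with ⟨l, hl | hl⟩
  · have : k = t + 2 * l := by omega
    subst this
    exact ⟨l, hk, by omega⟩
  · have : k = (t + 2 * l) + 1 := by omega
    subst this
    refine ⟨l, by omega, ?_⟩
    have h1 := card_le_card (initialPart_succ_subset S ⟨t + 2 * l, by omega⟩)
    have h2 := h1.trans (card_insert_le _ _)
    dsimp only at h2
    omega

end Shift

/-! ### The weighted intersection theorem -/

section Weight

variable {n t J : ℕ} {𝒮 : Finset (Finset (Fin n))}

/-- The number of partitions whose set of singletons belongs to `𝒮`. -/
noncomputable def weight (𝒮 : Finset (Finset (Fin n))) : ℕ := ∑ S ∈ 𝒮, singletonCount S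

lemma weight_eq_card (𝒮 : Finset (Finset (Fin n))) :
    weight 𝒮 = ((partitions n).filter fun P => singletons P ∈ 𝒮).card := by
  unfold weight singletonCount
  rw [card_eq_sum_card_fiberwise (s := (partitions n).filter fun P => singletons P ∈ 𝒮)
    (f := singletons) (t := 𝒮) fun P hP => (mem_filter.1 hP).2]
  refine sum_congr rfl fun S hS => ?_
  rw [filter_filter]
  congr 1
  refine filter_congr fun P _ => ?_
  constructor
  · rintro rfl
    exact ⟨hS, rfl⟩
  · exact fun h => h.2

/-- The set consisting of the first `t` elements. -/
def initialSegment (n t : ℕ) : Finset (Fin n) := initialPart univ t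

lemma bell_pos (m : ℕ) : 0 < bell m := by
  rw [← card_partitions]
  exact card_pos.2 ⟨_, mem_partitions.2 (isPartition_fibers (id : Fin m → Fin m))⟩

lemma weight_lt_of_not_mem {T : Finset (Fin n)} (hT : T ∉ 𝒮) :
    (((partitions n).filter fun P => singletons P ∈ 𝒮).filter fun P => T ⊆ singletons P).card +
      singletonCount T ≤ bell (n - T.card) := by
  rw [← card_starFamily, singletonCount, ← card_union_of_disjoint]
  · refine card_le_card ?_
    intro P hP
    rw [mem_starFamily]
    rcases mem_union.1 hP with h | h
    · rw [mem_filter, mem_filter, mem_partitions] at h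
      exact ⟨h.1.1, h.2⟩
    · rw [mem_filter, mem_partitions] at h
      exact ⟨h.1, h.2.ge⟩
  · rw [disjoint_left]
    intro P h h'
    rw [mem_filter, mem_filter] at h
    rw [mem_filter] at h'
    exact hT (h'.2 ▸ h.1.2)

lemma bell_le_singletonCount {T : Finset (Fin n)} (hT : T.card + 2 ≤ n) :
    bell (n - T.card - 2) ≤ singletonCount T := by
  have hc : 1 < (Tᶜ).card := by
    rw [card_compl, Fintype.card_fin]
    omega
  obtain ⟨u, hu, v, hv, huv⟩ := one_lt_card.1 hc
  rw [mem_compl] at hu hv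
  refine le_trans (le_of_eq ?_) (card_starFamily_le_singletonCount hu hv huv)
  rw [card_starFamily, card_insert_of_notMem, card_insert_of_notMem hv]
  · rfl
  · simp [huv, hu]

/-- In a shifted `t`-intersecting family, the members not containing the first `t` elements have
small weight. -/
lemma card_filter_not_initialSegment_subset_le
    (hint : ∀ A ∈ 𝒮, ∀ B ∈ 𝒮, t ≤ (A ∩ B).card)
    (hshift : ∀ i j, i < j → ∀ S ∈ 𝒮, shift i j S ∈ 𝒮) :
    (((partitions n).filter fun P => singletons P ∈ 𝒮).filter
      fun P => ¬ initialSegment n t ⊆ singletons P).card ≤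
      ∑ l ∈ Icc 1 ((n - t) / 2), (t + 2 * l).choose (t + l) * bell (n - (t + l)) := by
  have hsub : (((partitions n).filter fun P => singletons P ∈ 𝒮).filter
      fun P => ¬ initialSegment n t ⊆ singletons P) ⊆
      (Icc 1 ((n - t) / 2)).biUnion fun l =>
        ((initialSegment n (t + 2 * l)).powersetCard (t + l)).biUnion starFamily := by
    intro P hP
    rw [mem_filter, mem_filter, mem_partitions] at hP
    obtain ⟨⟨hP, hPS⟩, hPt⟩ := hP
    obtain ⟨l, hl, hcard⟩ := exists_card_initialPart_ge hint hshift hPS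
    have hl0 : l ≠ 0 := by
      rintro rfl
      apply hPt
      have h1 : initialPart (singletons P) t ⊆ initialSegment n t :=
        initialPart_mono (subset_univ _) le_rfl
      have h2 : initialPart (singletons P) t = initialSegment n t := by
        refine eq_of_subset_of_card_le h1 ?_
        rw [initialSegment, card_initialPart_univ (by omega)]
        exact hcard
      rw [← h2]
      exact filter_subset _ _
    obtain ⟨A, hA, hAc⟩ := exists_subset_card_eq hcard
    rw [mem_biUnion]
    refine ⟨l, mem_Icc.2 ⟨by omega, by omega⟩, mem_biUnion.2 ⟨A, mem_powersetCard.2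
      ⟨hA.trans (initialPart_mono (subset_univ _) le_rfl), hAc⟩, mem_starFamily.2
      ⟨hP, hA.trans (filter_subset _ _)⟩⟩⟩
  refine (card_le_card hsub).trans (card_biUnion_le.trans (sum_le_sum fun l hl => ?_))
  rw [mem_Icc] at hl
  refine card_biUnion_le.trans ?_
  have : ∀ A ∈ (initialSegment n (t + 2 * l)).powersetCard (t + l),
      (starFamily A).card = bell (n - (t + l)) := fun A hA => by
    rw [card_starFamily, (mem_powersetCard.1 hA).2]
  rw [sum_congr rfl this, sum_const, card_powersetCard, initialSegment,
    card_initialPart_univ (by omega), smul_eq_mul]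

lemma weight_of_shifted (htn : t + 2 ≤ n)
    (hsmall : ∑ l ∈ Icc 1 ((n - t) / 2), (t + 2 * l).choose (t + l) * bell (n - (t + l)) +
      J * bell (n - t - 1) < bell (n - t))
    (hlarge : n.choose J * bell (n - J) < bell (n - t - 2))
    (hint : ∀ A ∈ 𝒮, ∀ B ∈ 𝒮, t ≤ (A ∩ B).card)
    (hshift : ∀ i j, i < j → ∀ S ∈ 𝒮, shift i j S ∈ 𝒮) :
    weight 𝒮 < bell (n - t) ∨ (initialSegment n t ∈ 𝒮 ∧ weight 𝒮 ≤ bell (n - t)) := by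
  set T := initialSegment n t with hTdef
  have hTc : T.card = t := card_initialPart_univ (by omega)
  have hsplit := card_filter_add_card_filter_not (s := (partitions n).filter
    fun P => singletons P ∈ 𝒮) fun P => T ⊆ singletons P
  rw [← weight_eq_card] at hsplit
  have hTcount := bell_le_singletonCount (T := T) (by omega)
  rw [hTc] at hTcount
  have hpos := bell_pos (n - t - 2)
  by_cases hall : ∀ S ∈ 𝒮, T ⊆ S
  · have hempty : (((partitions n).filter fun P => singletons P ∈ 𝒮).filter
        fun P => ¬ T ⊆ singletons P) = ∅ :=
      filter_eq_empty_iff.2 fun P hP h => h (hall _ (mem_filter.1 hP).2)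
    rw [hempty, card_empty, add_zero] at hsplit
    by_cases hT : T ∈ 𝒮
    · right
      refine ⟨hT, ?_⟩
      rw [← hsplit, ← hTc, ← card_starFamily]
      refine card_le_card fun P hP => ?_
      rw [mem_filter, mem_filter, mem_partitions] at hP
      exact mem_starFamily.2 ⟨hP.1.1, hP.2⟩
    · left
      have := weight_lt_of_not_mem hT
      rw [hTc] at this
      omega
  · left
    by_cases hs : ∃ S ∈ 𝒮, ¬ T ⊆ S ∧ S.card ≤ J
    · obtain ⟨S, hS, hTS, hSJ⟩ := hs
      have hmain : (((partitions n).filter fun P => singletons P ∈ 𝒮).filter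
          fun P => T ⊆ singletons P).card ≤ J * bell (n - t - 1) := by
        have hsub : (((partitions n).filter fun P => singletons P ∈ 𝒮).filter
            fun P => T ⊆ singletons P) ⊆ (S \ T).biUnion fun x => starFamily (insert x T) := by
          intro P hP
          rw [mem_filter, mem_filter, mem_partitions] at hP
          obtain ⟨⟨hP, hPS⟩, hTP⟩ := hP
          have hx : ∃ x ∈ S ∩ singletons P, x ∉ T := by
            by_contra! h
            have hsub : S ∩ singletons P ⊆ T := h
            have heq : S ∩ singletons P = T :=
              eq_of_subset_of_card_le hsub (hTc.trans_le (hint _ hS _ hPS))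
            exact hTS (heq ▸ inter_subset_left)
          obtain ⟨x, hx, hxT⟩ := hx
          obtain ⟨hxS, hxP⟩ := mem_inter.1 hx
          exact mem_biUnion.2 ⟨x, mem_sdiff.2 ⟨hxS, hxT⟩, mem_starFamily.2
            ⟨hP, insert_subset hxP hTP⟩⟩
        refine (card_le_card hsub).trans (card_biUnion_le.trans ?_)
        have : ∀ x ∈ S \ T, (starFamily (insert x T)).card = bell (n - t - 1) := fun x hx => by
          rw [card_starFamily, card_insert_of_notMem (mem_sdiff.1 hx).2, hTc]
          rfl
        rw [sum_congr rfl this, sum_const, smul_eq_mul]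
        exact Nat.mul_le_mul_right _ ((card_le_card sdiff_subset).trans hSJ)
      have := card_filter_not_initialSegment_subset_le hint hshift
      rw [← hTdef] at this
      omega
    · push Not at hs
      have hT : T ∉ 𝒮 := by
        intro hT
        push Not at hall
        obtain ⟨S, hS, hTS⟩ := hall
        have heq : T ∩ S = T :=
          eq_of_subset_of_card_le inter_subset_left (hTc.trans_le (hint _ hT _ hS))
        exact hTS (inter_eq_left.1 heq)
      have hgain : (((partitions n).filter fun P => singletons P ∈ 𝒮).filter
          fun P => ¬ T ⊆ singletons P).card ≤ n.choose J * bell (n - J) := by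
        have hsub : (((partitions n).filter fun P => singletons P ∈ 𝒮).filter
            fun P => ¬ T ⊆ singletons P) ⊆
            ((univ : Finset (Fin n)).powersetCard J).biUnion starFamily := by
          intro P hP
          rw [mem_filter, mem_filter, mem_partitions] at hP
          obtain ⟨⟨hP, hPS⟩, hTP⟩ := hP
          obtain ⟨A, hA, hAc⟩ := exists_subset_card_eq (hs _ hPS hTP).le
          exact mem_biUnion.2 ⟨A, mem_powersetCard.2 ⟨subset_univ _, hAc⟩,
            mem_starFamily.2 ⟨hP, hA⟩⟩
        refine (card_le_card hsub).trans (card_biUnion_le.trans_eq ?_)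
        have : ∀ A ∈ (univ : Finset (Fin n)).powersetCard J,
            (starFamily A).card = bell (n - J) := fun A hA => by
          rw [card_starFamily, (mem_powersetCard.1 hA).2]
        rw [sum_congr rfl this, sum_const, card_powersetCard, card_univ, Fintype.card_fin,
          smul_eq_mul]
      have := weight_lt_of_not_mem hT
      rw [hTc] at this
      omega

/-- Among families of subsets, the weight of a `t`-intersecting family is maximised by a star. -/
theorem weight_le (htn : t + 2 ≤ n)
    (hsmall : ∑ l ∈ Icc 1 ((n - t) / 2), (t + 2 * l).choose (t + l) * bell (n - (t + l)) +
      J * bell (n - t - 1) < bell (n - t))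
    (hlarge : n.choose J * bell (n - J) < bell (n - t - 2))
    (hint : ∀ A ∈ 𝒮, ∀ B ∈ 𝒮, t ≤ (A ∩ B).card) :
    weight 𝒮 ≤ bell (n - t) ∧ (weight 𝒮 = bell (n - t) → ∃ T ∈ 𝒮, T.card = t) := by
  suffices H : ∀ m : ℕ, ∀ 𝒮 : Finset (Finset (Fin n)), (∑ S ∈ 𝒮, ∑ x ∈ S, x.val) = m →
      (∀ A ∈ 𝒮, ∀ B ∈ 𝒮, t ≤ (A ∩ B).card) →
      weight 𝒮 ≤ bell (n - t) ∧ (weight 𝒮 = bell (n - t) → ∃ T ∈ 𝒮, T.card = t) from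
    H _ 𝒮 rfl hint
  clear hint
  intro m
  induction m using Nat.strong_induction_on with
  | _ m ih =>
    intro 𝒮 hm hint
    by_cases hshift : ∀ i j, i < j → ∀ S ∈ 𝒮, shift i j S ∈ 𝒮
    · rcases weight_of_shifted htn hsmall hlarge hint hshift with h | ⟨h1, h2⟩
      · exact ⟨h.le, fun h' => absurd h' h.ne⟩
      · exact ⟨h2, fun _ => ⟨_, h1, card_initialPart_univ (by omega)⟩⟩
    · push Not at hshift
      obtain ⟨i, j, hij, S₀, hS₀, hS₀'⟩ := hshift
      have hinj : ∀ a ∈ 𝒮, ∀ b ∈ 𝒮, shift i j a ≠ a → shift i j b ≠ b →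
          shift i j a = shift i j b → a = b := fun a _ b _ => shift_injective
      have hw : weight (compress (shift i j) 𝒮) = weight 𝒮 := by
        unfold weight
        rw [sum_compress _ hinj]
        refine sum_congr rfl fun S _ => ?_
        unfold compressMap
        split_ifs
        · rfl
        · exact singletonCount_shift i j S
      have hle : ∀ S, shift i j S ≠ S → ∑ x ∈ shift i j S, x.val < ∑ x ∈ S, x.val := by
        intro S h
        obtain ⟨hj, hi⟩ := mem_of_shift_ne h
        rw [shift_of_mem hj hi, sum_insert fun h => hi (mem_of_mem_erase h),
          ← add_sum_erase S (fun x => x.val) hj]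
        exact Nat.add_lt_add_right hij _
      have hlt : ∑ S ∈ compress (shift i j) 𝒮, ∑ x ∈ S, x.val < m := by
        rw [sum_compress _ hinj, ← hm]
        refine sum_lt_sum (fun S hS => ?_) ⟨S₀, hS₀, ?_⟩
        · unfold compressMap
          split_ifs with h
          · exact le_rfl
          · exact (hle S fun e => h (e.symm ▸ hS)).le
        · unfold compressMap
          rw [if_neg hS₀']
          exact hle S₀ fun e => hS₀' (e.symm ▸ hS₀)
      obtain ⟨h1, h2⟩ := ih _ hlt _ rfl (compress_shift_inter hint)
      rw [hw] at h1 h2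
      refine ⟨h1, fun h => ?_⟩
      obtain ⟨T', hT', hc⟩ := h2 h
      obtain ⟨T, hT, rfl⟩ := mem_image.1 hT'
      refine ⟨T, hT, ?_⟩
      rw [← hc]
      unfold compressMap
      split_ifs
      · rfl
      · exact (card_shift i j T).symm

end Weight

/-! ### Reduction of families of partitions to families of sets of singletons -/

section Reduction

variable {n t J : ℕ} {F : Finset (Finset (Finset (Fin n)))}

/-- The partition of `[n]` consisting of the singletons in `T` and the complement of `T`. -/
noncomputable def coarsePartition (T : Finset (Fin n)) : Finset (Finset (Fin n)) :=
  insert Tᶜ (T.image fun x => {x})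

lemma mem_coarsePartition {T b : Finset (Fin n)} :
    b ∈ coarsePartition T ↔ b = Tᶜ ∨ ∃ x ∈ T, {x} = b := by
  simp [coarsePartition]

lemma coarsePartition_mem_starFamily {T : Finset (Fin n)} (hT : T.card < n) :
    coarsePartition T ∈ starFamily T := by
  rw [mem_starFamily]
  refine ⟨⟨?_, ?_, ?_⟩, ?_⟩
  · rw [mem_coarsePartition]
    rintro (h | ⟨x, -, h⟩)
    · have : T = univ := by rw [← compl_compl T, ← h, compl_empty]
      rw [this, card_univ, Fintype.card_fin] at hT
      exact lt_irrefl _ hT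
    · exact singleton_ne_empty x h
  · intro p hp q hq hpq
    rw [mem_coarsePartition] at hp hq
    rcases hp with rfl | ⟨x, hx, rfl⟩ <;> rcases hq with rfl | ⟨y, hy, rfl⟩
    · exact absurd rfl hpq
    · simpa using hy
    · simpa using hx
    · rw [disjoint_singleton]
      exact fun h => hpq (by rw [h])
  · intro x
    by_cases hx : x ∈ T
    · exact ⟨{x}, mem_coarsePartition.2 (Or.inr ⟨x, hx, rfl⟩), mem_singleton_self x⟩
    · exact ⟨Tᶜ, mem_coarsePartition.2 (Or.inl rfl), mem_compl.2 hx⟩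
  · intro x hx
    exact mem_singletons.2 (mem_coarsePartition.2 (Or.inr ⟨x, hx, rfl⟩))

/-- A partition sharing at least `T.card` blocks with the coarse partition of `T` has all elements
of `T` as singletons. -/
lemma mem_starFamily_of_card_le_inter {T : Finset (Fin n)} {P : Finset (Finset (Fin n))}
    (hT : T.card < n) (hP : IsPartition P) (h : T.card ≤ (P ∩ coarsePartition T).card) :
    P ∈ starFamily T := by
  have hR := (mem_starFamily.1 (coarsePartition_mem_starFamily hT)).1
  rw [mem_starFamily]
  refine ⟨hP, fun z hz => mem_singletons.2 ?_⟩
  by_contra hzP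
  obtain ⟨b, hb, hzb⟩ := hP.2.2 z
  have hw : ∃ w ∈ b, w ≠ z := by
    by_contra! hw
    exact hzP (by rwa [eq_singleton_iff_unique_mem.2 ⟨hzb, hw⟩] at hb)
  obtain ⟨w, hwb, hwz⟩ := hw
  obtain ⟨c, hc, hwc⟩ := hR.2.2 w
  have hzR : {z} ∈ coarsePartition T := mem_coarsePartition.2 (Or.inr ⟨z, hz, rfl⟩)
  have hcz : c ≠ {z} := by
    rintro rfl
    exact hwz (mem_singleton.1 hwc)
  have hcP : c ∉ P := by
    intro hcP
    have : z ∈ c := by rwa [hP.eq_of_mem hcP hb hwc hwb]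
    exact hcz (hR.eq_of_mem hc hzR this (mem_singleton_self z))
  have hsub : P ∩ coarsePartition T ⊆ ((coarsePartition T).erase {z}).erase c := by
    intro d hd
    obtain ⟨hdP, hdR⟩ := mem_inter.1 hd
    exact mem_erase.2 ⟨fun e => hcP (e ▸ hdP), mem_erase.2 ⟨fun e => hzP (e ▸ hdP), hdR⟩⟩
  have h1 := card_le_card hsub
  rw [card_erase_of_mem (mem_erase.2 ⟨hcz, hc⟩), card_erase_of_mem hzR] at h1
  have h2 : (coarsePartition T).card ≤ T.card + 1 :=
    (card_insert_le _ _).trans (Nat.add_le_add_right card_image_le 1)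
  have h3 : 0 < T.card := card_pos.2 ⟨z, hz⟩
  omega

lemma card_inter_lt_of_splitOff_eq_coarsePartition {T : Finset (Fin n)} {x y : Fin n}
    {Q A : Finset (Finset (Fin n))} (hT : T.card + 2 ≤ n) (hQ : IsPartition Q)
    (hj : SameBlock x y Q) (hxy : x ≠ y) (hQR : splitOff x y Q = coarsePartition T)
    (hA : ∀ c ∈ A, c ≠ {x} → ∃ w, c.erase x = {w}) : (Q ∩ A).card < T.card := by
  have hTc : 1 < (Tᶜ).card := by
    rw [card_compl, Fintype.card_fin]
    omega
  have hsingle : ∀ w, {w} ∈ coarsePartition T → w ∈ T := by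
    intro w hw
    rcases mem_coarsePartition.1 hw with h | ⟨z, hz, h⟩
    · rw [← h, card_singleton] at hTc
      exact absurd hTc (lt_irrefl 1)
    · rwa [← singleton_injective h]
  have hxT : x ∈ T := hsingle x (by rw [← hQR, mem_splitOff hj]; exact Or.inl rfl)
  have key : ∀ c ∈ Q ∩ A, ∃ w ∈ T.erase x, c.erase x = {w} := by
    intro c hc
    obtain ⟨hcQ, hcA⟩ := mem_inter.1 hc
    have hcx : c ≠ {x} := by
      rintro rfl
      exact hxy (mem_singleton.1 (hj.mem_right hQ hcQ (mem_singleton_self x))).symm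
    obtain ⟨w, hw⟩ := hA c hcA hcx
    have hwx : w ≠ x := (mem_erase.1 (hw ▸ mem_singleton_self w : w ∈ c.erase x)).1
    refine ⟨w, mem_erase.2 ⟨hwx, hsingle w ?_⟩, hw⟩
    rw [← hw, ← hQR, mem_splitOff hj]
    by_cases hx : x ∈ c
    · exact Or.inr (Or.inr ⟨c, hcQ, hx, rfl⟩)
    · rw [erase_eq_of_notMem hx]
      exact Or.inr (Or.inl ⟨hcQ, hx⟩)
  have h1 : (Q ∩ A).card ≤ ((T.erase x).image fun w => ({w} : Finset (Fin n))).card := by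
    refine card_le_card_of_injOn (fun c => c.erase x) ?_ ?_
    · intro c hc
      obtain ⟨w, hw, h⟩ := key c hc
      exact mem_image.2 ⟨w, hw, h.symm⟩
    · intro c hc d hd h
      obtain ⟨w, -, hw⟩ := key c hc
      have hwc : w ∈ c.erase x := hw ▸ mem_singleton_self w
      have hwd : w ∈ d.erase x := (show c.erase x = d.erase x from h) ▸ hwc
      exact hQ.eq_of_mem (mem_inter.1 hc).1 (mem_inter.1 hd).1 (mem_of_mem_erase hwc)
        (mem_of_mem_erase hwd)
  refine (h1.trans card_image_le).trans_lt (card_erase_lt_of_mem hxT)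

/-- If a split compression of a `t`-intersecting family is a star, so is the family itself. -/
lemma eq_starFamily_of_compress_eq {T : Finset (Fin n)} {x y : Fin n} (hT : T.card + 2 ≤ n)
    (hF : ∀ P ∈ F, IsPartition P) (hint : ∀ P ∈ F, ∀ Q ∈ F, T.card ≤ (P ∩ Q).card) (hxy : x ≠ y)
    (h : compress (splitOff x y) F = starFamily T) : F = starFamily T := by
  have hcard : F.card = (starFamily T).card := by
    rw [← h, card_compress]
    exact fun P hP Q hQ => splitOff_injective (hF P hP) (hF Q hQ) hxy
  have hmem : ∀ R ∈ starFamily T, R ∈ F ∨ ∃ Q ∈ F, SameBlock x y Q ∧ splitOff x y Q = R := by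
    intro R hR
    rw [← h] at hR
    obtain ⟨Q, hQ, rfl⟩ := mem_image.1 hR
    unfold compressMap
    split_ifs with hs
    · exact Or.inl hQ
    · exact Or.inr ⟨Q, hQ, sameBlock_of_splitOff_ne fun e => hs (by rwa [e]), rfl⟩
  rcases hmem _ (coarsePartition_mem_starFamily (by omega : T.card < n)) with hR | ⟨Q, hQ, hj, hQR⟩
  · exact eq_of_subset_of_card_le (fun P hP => mem_starFamily_of_card_le_inter (by omega) (hF P hP)
      (hint P hP _ hR)) hcard.ge
  · exfalso
    have hD : fibers (id : Fin n → Fin n) ∈ starFamily T :=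
      mem_starFamily.2 ⟨isPartition_fibers _, fun z _ => mem_singletons.2
        (mem_fibers.2 ⟨z, fun w => mem_singleton⟩)⟩
    have hDs : ∀ c ∈ fibers (id : Fin n → Fin n), ∃ w, c = {w} := by
      intro c hc
      obtain ⟨w, hw⟩ := mem_fibers.1 hc
      exact ⟨w, by ext z; rw [hw, mem_singleton]; rfl⟩
    rcases hmem _ hD with hDF | ⟨A, hA, hjA, hAD⟩
    · refine absurd (hint Q hQ _ hDF) (not_le.2 (card_inter_lt_of_splitOff_eq_coarsePartition hT
        (hF Q hQ) hj hxy hQR fun c hc hcx => ?_))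
      obtain ⟨w, rfl⟩ := hDs c hc
      exact ⟨w, erase_eq_of_notMem fun e => hcx (by rw [mem_singleton.1 e])⟩
    · refine absurd (hint Q hQ _ hA) (not_le.2 (card_inter_lt_of_splitOff_eq_coarsePartition hT
        (hF Q hQ) hj hxy hQR fun c hc hcx => hDs _ ?_))
      rw [← hAD, mem_splitOff hjA]
      by_cases hx : x ∈ c
      · exact Or.inr (Or.inr ⟨c, hc, hx, rfl⟩)
      · rw [erase_eq_of_notMem hx]
        exact Or.inr (Or.inl ⟨hc, hx⟩)

theorem card_le_bell_of_closed (htn : t + 2 ≤ n)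
    (hsmall : ∑ l ∈ Icc 1 ((n - t) / 2), (t + 2 * l).choose (t + l) * bell (n - (t + l)) +
      J * bell (n - t - 1) < bell (n - t))
    (hlarge : n.choose J * bell (n - J) < bell (n - t - 2))
    (hF : ∀ P ∈ F, IsPartition P) (hint : ∀ P ∈ F, ∀ Q ∈ F, t ≤ (P ∩ Q).card)
    (hclosed : ∀ x y, x ≠ y → ∀ P ∈ F, splitOff x y P ∈ F) :
    F.card ≤ bell (n - t) ∧
      (F.card = bell (n - t) → ∃ T : Finset (Fin n), T.card = t ∧ F = starFamily T) := by
  have hS := le_card_singletons_inter hF hint hclosed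
  obtain ⟨h1, h2⟩ := weight_le (𝒮 := F.image singletons) htn hsmall hlarge (by
    intro A hA B hB
    obtain ⟨P, hP, rfl⟩ := mem_image.1 hA
    obtain ⟨Q, hQ, rfl⟩ := mem_image.1 hB
    exact hS P hP Q hQ)
  have hle : F.card ≤ weight (F.image singletons) := by
    rw [weight_eq_card]
    exact card_le_card fun P hP => mem_filter.2
      ⟨mem_partitions.2 (hF P hP), mem_image_of_mem _ hP⟩
  refine ⟨hle.trans h1, fun h => ?_⟩
  obtain ⟨T, hT, hTc⟩ := h2 (le_antisymm h1 (h ▸ hle))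
  obtain ⟨Q, hQ, rfl⟩ := mem_image.1 hT
  refine ⟨_, hTc, eq_of_subset_of_card_le (fun P hP => mem_starFamily.2 ⟨hF P hP, ?_⟩) ?_⟩
  · exact inter_eq_left.1 (eq_of_subset_of_card_le inter_subset_left
      (hTc.trans_le (hS Q hQ P hP)))
  · rw [card_starFamily, hTc, h]

/-- The extremal theorem, under explicit inequalities between Bell numbers. -/
theorem card_le_bell (htn : t + 2 ≤ n)
    (hsmall : ∑ l ∈ Icc 1 ((n - t) / 2), (t + 2 * l).choose (t + l) * bell (n - (t + l)) +
      J * bell (n - t - 1) < bell (n - t))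
    (hlarge : n.choose J * bell (n - J) < bell (n - t - 2))
    (hF : ∀ P ∈ F, IsPartition P) (hint : ∀ P ∈ F, ∀ Q ∈ F, t ≤ (P ∩ Q).card) :
    F.card ≤ bell (n - t) ∧
      (F.card = bell (n - t) → ∃ T : Finset (Fin n), T.card = t ∧ F = starFamily T) := by
  induction hm : ∑ P ∈ F, (Fintype.card (Finset (Fin n)) - P.card) using
    Nat.strong_induction_on generalizing F with
  | _ m ih =>
    by_cases hclosed : ∀ x y, x ≠ y → ∀ P ∈ F, splitOff x y P ∈ F
    · exact card_le_bell_of_closed htn hsmall hlarge hF hint hclosed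
    push Not at hclosed
    obtain ⟨x, y, hxy, P₀, hP₀, hP₀'⟩ := hclosed
    have hinj : ∀ P ∈ F, ∀ Q ∈ F, splitOff x y P ≠ P → splitOff x y Q ≠ Q →
        splitOff x y P = splitOff x y Q → P = Q :=
      fun P hP Q hQ => splitOff_injective (hF P hP) (hF Q hQ) hxy
    have hdrop : ∀ P ∈ F, splitOff x y P ∉ F →
        Fintype.card (Finset (Fin n)) - (splitOff x y P).card <
          Fintype.card (Finset (Fin n)) - P.card := by
      intro P hP h
      have h1 := card_lt_card_splitOff (hF P hP) hxy
        (sameBlock_of_splitOff_ne fun e => h (by rwa [e]))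
      have h2 := card_le_univ (splitOff x y P)
      omega
    have hlt : ∑ P ∈ compress (splitOff x y) F, (Fintype.card (Finset (Fin n)) - P.card) < m := by
      rw [sum_compress _ hinj, ← hm]
      refine sum_lt_sum (fun P hP => ?_) ⟨P₀, hP₀, ?_⟩
      · unfold compressMap
        split_ifs with h
        · exact le_rfl
        · exact (hdrop P hP h).le
      · unfold compressMap
        rw [if_neg hP₀']
        exact hdrop P₀ hP₀ hP₀'
    obtain ⟨h1, h2⟩ := ih _ hlt (forall_mem_compress hF fun P hP => hP.splitOff hxy)
      (compress_splitOff_inter hF hint hxy) rfl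
    rw [card_compress hinj] at h1 h2
    refine ⟨h1, fun h => ?_⟩
    obtain ⟨T, rfl, hTF⟩ := h2 h
    exact ⟨T, rfl, eq_starFamily_of_compress_eq htn hF hint hxy hTF⟩

end Reduction

/-! ### Growth of Bell numbers -/

section Growth

variable {n t J L : ℕ}

lemma pow_mul_bell_le {m : ℕ} (hL : 1 ≤ L) (hJ : 1 ≤ J) (hnL : n < 2 ^ L)
    (hJL : 160 * (J * L) ≤ n) (hm : n ≤ 5 * m) (l : ℕ) :
    (2 * J) ^ l * bell m ≤ bell (m + l) := by
  have hJJ : J ≤ J * L := Nat.le_mul_of_pos_right _ hL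
  induction l with
  | zero => simp
  | succ l ih =>
    refine le_trans ?_ (mul_bell_le_bell_succ (R := 2 * J) (N := m + l) (by omega) (by omega) ?_)
    · rw [pow_succ', mul_assoc]
      exact Nat.mul_le_mul_left _ ih
    · calc (8 * (2 * J)) ^ (2 * (8 * (2 * J))) ≤ (2 ^ L) ^ (2 * (8 * (2 * J))) :=
            Nat.pow_le_pow_left (by omega) _
        _ = 2 ^ (32 * (J * L)) := by
            rw [← pow_mul]
            congr 1
            ring
        _ ≤ 2 ^ (m + l) := Nat.pow_le_pow_right (by norm_num) (by omega)

lemma choose_add_two_mul_le (ht : 2 ≤ t) (l : ℕ) : (t + 2 * l).choose (t + l) ≤ (4 * t) ^ l := by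
  rw [← Nat.choose_symm_of_eq_add (by ring : t + 2 * l = l + (t + l))]
  induction l with
  | zero => simp
  | succ l ih =>
    have h1 := Nat.add_one_mul_choose_eq (t + 2 * l + 1) l
    have h2 := Nat.choose_mul_succ_eq (t + 2 * l) l
    rw [show t + 2 * l + 1 - l = t + l + 1 by omega] at h2
    have h3 : (t + 2 * l + 1).choose l ≤ 2 * (t + 2 * l).choose l := by
      refine Nat.le_of_mul_le_mul_right (c := t + l + 1) ?_ (by omega)
      rw [← h2]
      nlinarith [Nat.zero_le ((t + 2 * l).choose l)]
    have h4 : (t + 2 * l + 1 + 1).choose (l + 1) ≤ (t + 2) * (t + 2 * l + 1).choose l := by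
      refine Nat.le_of_mul_le_mul_right (c := l + 1) ?_ (by omega)
      rw [← h1]
      nlinarith [Nat.zero_le ((t + 2 * l + 1).choose l), Nat.zero_le (t * l)]
    calc (t + 2 * (l + 1)).choose (l + 1) ≤ (t + 2) * (t + 2 * l + 1).choose l := h4
      _ ≤ (2 * t) * (2 * (4 * t) ^ l) :=
          Nat.mul_le_mul (by omega) (h3.trans (Nat.mul_le_mul_left _ ih))
      _ = (4 * t) ^ (l + 1) := by ring

lemma three_mul_sum_Icc_le {a : ℕ → ℕ} {B m : ℕ} (h : ∀ l ∈ Icc 1 m, 4 ^ l * a l ≤ B) :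
    3 * ∑ l ∈ Icc 1 m, a l ≤ B := by
  suffices H : ∀ k ≤ m, 3 * (4 ^ k * ∑ l ∈ Icc 1 k, a l) + B ≤ 4 ^ k * B by
    refine Nat.le_of_mul_le_mul_left (c := 4 ^ m) ?_ (by positivity)
    have := H m le_rfl
    linarith
  intro k hk
  induction k with
  | zero => simp
  | succ k ih =>
    have h1 := ih (by omega)
    have h2 := h (k + 1) (mem_Icc.2 ⟨by omega, hk⟩)
    rw [sum_Icc_succ_top (by omega), mul_add]
    rw [pow_succ] at h2 ⊢
    linarith

lemma sum_choose_mul_bell_lt (ht : 2 ≤ t) (hL : 1 ≤ L) (hnL : n < 2 ^ L)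
    (hJL : 160 * (J * L) ≤ n) (hJt : 8 * t ≤ J) :
    ∑ l ∈ Icc 1 ((n - t) / 2), (t + 2 * l).choose (t + l) * bell (n - (t + l)) +
      J * bell (n - t - 1) < bell (n - t) := by
  have hJJ : J ≤ J * L := Nat.le_mul_of_pos_right _ hL
  have h1 : 3 * ∑ l ∈ Icc 1 ((n - t) / 2), (t + 2 * l).choose (t + l) * bell (n - (t + l)) ≤
      bell (n - t) := by
    refine three_mul_sum_Icc_le fun l hl => ?_
    rw [mem_Icc] at hl
    have h := pow_mul_bell_le (m := n - (t + l)) hL (by omega) hnL hJL (by omega) l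
    rw [show n - (t + l) + l = n - t by omega] at h
    refine le_trans ?_ h
    rw [← mul_assoc]
    refine Nat.mul_le_mul_right _ ((Nat.mul_le_mul_left _ (choose_add_two_mul_le ht l)).trans ?_)
    rw [← mul_pow]
    exact Nat.pow_le_pow_left (by omega) _
  have h2 := pow_mul_bell_le (m := n - t - 1) hL (by omega) hnL hJL (by omega) 1
  rw [show n - t - 1 + 1 = n - t by omega, pow_one, mul_assoc] at h2
  have h3 := bell_pos (n - t)
  omega

lemma pow_self_le_three_pow_mul_factorial (J : ℕ) : J ^ J ≤ 3 ^ J * J.factorial := by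
  have h1 : (J : ℝ) ^ J / J.factorial ≤ Real.exp J :=
    Real.pow_div_factorial_le_exp _ (Nat.cast_nonneg J) J
  have h2 : Real.exp J ≤ 3 ^ J := by
    rw [← Real.exp_one_pow]
    exact pow_le_pow_left₀ (Real.exp_pos 1).le (by linarith [Real.exp_one_lt_d9]) J
  have h3 : (J : ℝ) ^ J ≤ 3 ^ J * J.factorial :=
    (div_le_iff₀ (by exact_mod_cast J.factorial_pos)).1 (h1.trans h2)
  exact_mod_cast h3

lemma choose_mul_pow_self_le (n J : ℕ) : n.choose J * J ^ J ≤ (3 * n) ^ J := by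
  calc n.choose J * J ^ J ≤ n.choose J * (3 ^ J * J.factorial) :=
        Nat.mul_le_mul_left _ (pow_self_le_three_pow_mul_factorial J)
    _ = 3 ^ J * n.descFactorial J := by
        rw [Nat.descFactorial_eq_factorial_mul_choose]
        ring
    _ ≤ 3 ^ J * n ^ J := Nat.mul_le_mul_left _ (Nat.descFactorial_le_pow n J)
    _ = (3 * n) ^ J := (mul_pow ..).symm

lemma choose_lt_pow {k : ℕ} (hJ : 1 ≤ J) (hk : 3 * J ≤ 4 * k) (h : (3 * n) ^ 4 < J ^ 7) :
    n.choose J < (2 * J) ^ k := by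
  by_contra! hc
  have h1 : (J ^ 7) ^ J ≤ ((3 * n) ^ 4) ^ J := by
    calc (J ^ 7) ^ J = J ^ (3 * J) * (J ^ J) ^ 4 := by
          rw [← pow_mul, ← pow_mul, ← pow_add]
          congr 1
          ring
      _ ≤ ((2 * J) ^ k) ^ 4 * (J ^ J) ^ 4 := by
          refine Nat.mul_le_mul_right _ ?_
          rw [← pow_mul]
          exact (Nat.pow_le_pow_right hJ (by omega)).trans (Nat.pow_le_pow_left (by omega) _)
      _ = ((2 * J) ^ k * J ^ J) ^ 4 := (mul_pow ..).symm
      _ ≤ ((3 * n) ^ J) ^ 4 := Nat.pow_le_pow_left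
          ((Nat.mul_le_mul_right _ hc).trans (choose_mul_pow_self_le n J)) _
      _ = ((3 * n) ^ 4) ^ J := by rw [← pow_mul, ← pow_mul, mul_comm J 4]
  exact absurd h1 (not_le.2 (Nat.pow_lt_pow_left h (by omega)))

lemma choose_mul_bell_lt (ht : 2 ≤ t) (hL : 1 ≤ L) (hnL : n < 2 ^ L)
    (hJL : 160 * (J * L) ≤ n) (hJt : 8 * t ≤ J) (h : (3 * n) ^ 4 < J ^ 7) :
    n.choose J * bell (n - J) < bell (n - t - 2) := by
  have hJJ : J ≤ J * L := Nat.le_mul_of_pos_right _ hL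
  have h1 := pow_mul_bell_le (m := n - J) hL (by omega) hnL hJL (by omega) (J - t - 2)
  rw [show n - J + (J - t - 2) = n - t - 2 by omega] at h1
  exact (Nat.mul_lt_mul_of_pos_right (choose_lt_pow (by omega) (by omega) h) (bell_pos _)).trans_le
    h1

lemma two_pow_mul_pow_le (hL : 40 ≤ L) : 2 ^ 65 * L ^ 7 ≤ 2 ^ (3 * (L - 1)) := by
  induction L, hL using Nat.le_induction with
  | base => norm_num
  | succ L hL ih =>
    have h1 : (4 * (L + 1)) ^ 7 ≤ (5 * L) ^ 7 := Nat.pow_le_pow_left (by omega) 7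
    rw [mul_pow, mul_pow] at h1
    have h2 : (L + 1) ^ 7 ≤ 8 * L ^ 7 := by omega
    rw [show 3 * (L + 1 - 1) = 3 * (L - 1) + 3 by omega, pow_add]
    omega

/-- The logarithmic hypothesis on `n`, in terms of the binary length `L` of `n`. -/
lemma mul_length_le (ht : 2 ≤ t) (hn : (2 : ℝ) ^ 41 * t * Real.log t ^ 2 ≤ n) :
    40 ≤ Nat.log 2 n + 1 ∧ 1280 * (t * (Nat.log 2 n + 1)) ≤ n := by
  have ht' : (2 : ℝ) ≤ t := by exact_mod_cast ht
  have hlog2 : (0.69 : ℝ) ≤ Real.log 2 := by linarith [Real.log_two_gt_d9]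
  have hlogt : Real.log 2 ≤ Real.log t := Real.log_le_log (by norm_num) ht'
  have hn39 : 2 ^ 39 ≤ n := by
    have h1 : (0.69 : ℝ) ^ 2 ≤ Real.log t ^ 2 :=
      pow_le_pow_left₀ (by norm_num) (hlog2.trans hlogt) 2
    have h2 : (2 : ℝ) ^ 41 * 2 * 0.69 ^ 2 ≤ 2 ^ 41 * t * Real.log t ^ 2 := by gcongr
    have h3 : (2 : ℝ) ^ 39 ≤ n := by
      refine le_trans ?_ (h2.trans hn)
      norm_num
    exact_mod_cast h3
  have hlog : 39 ≤ Nat.log 2 n := Nat.le_log_of_pow_le (by norm_num) hn39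
  refine ⟨by omega, ?_⟩
  have hpow : 2 ^ Nat.log 2 n ≤ n := Nat.pow_log_le_self 2 (by omega)
  set k := Nat.log 2 n with hk
  by_cases hnt : n ≤ t ^ 4
  · have h1 : (k : ℝ) * Real.log 2 ≤ 4 * Real.log t := by
      have h : (2 : ℝ) ^ k ≤ (t : ℝ) ^ 4 := by exact_mod_cast hpow.trans hnt
      have := Real.log_le_log (by positivity) h
      rwa [Real.log_pow, Real.log_pow] at this
    have h2 : ((k : ℝ) + 1) * 0.69 ≤ 5 * Real.log t := by nlinarith
    have h3 : ((k : ℝ) + 1) * 0.69 * 0.69 ≤ 5 * Real.log t ^ 2 := by nlinarith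
    have h4 : (1280 : ℝ) * (t * (k + 1)) ≤ n := by
      refine le_trans ?_ hn
      have h5 : (1280 : ℝ) * (k + 1) ≤ 2 ^ 41 * Real.log t ^ 2 := by nlinarith
      nlinarith
    exact_mod_cast h4
  · push Not at hnt
    have h1 := two_pow_mul_pow_le (L := k + 1) (by omega)
    rw [Nat.add_sub_cancel, mul_comm 3, pow_mul] at h1
    have h2 : (2 ^ k) ^ 3 ≤ n ^ 3 := Nat.pow_le_pow_left hpow 3
    have h3 : (k + 1) ^ 4 ≤ (k + 1) ^ 7 := Nat.pow_le_pow_right (by omega) (by norm_num)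
    refine le_of_lt (lt_of_pow_lt_pow_left₀ 4 (Nat.zero_le _) ?_)
    calc (1280 * (t * (k + 1))) ^ 4 = t ^ 4 * (1280 ^ 4 * (k + 1) ^ 4) := by ring
      _ < n * (1280 ^ 4 * (k + 1) ^ 4) := Nat.mul_lt_mul_of_pos_right hnt (by positivity)
      _ ≤ n * n ^ 3 := Nat.mul_le_mul_left _ (by omega)
      _ = n ^ 4 := by ring

lemma pow_four_lt_div_pow (hL : 40 ≤ Nat.log 2 n + 1) (hn : 160 * (Nat.log 2 n + 1) ≤ n) :
    (3 * n) ^ 4 < (n / (160 * (Nat.log 2 n + 1))) ^ 7 := by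
  have hpow : 2 ^ Nat.log 2 n ≤ n := Nat.pow_log_le_self 2 (by omega)
  have h1 := two_pow_mul_pow_le hL
  rw [Nat.add_sub_cancel, mul_comm 3, pow_mul] at h1
  have h2 : (2 ^ Nat.log 2 n) ^ 3 ≤ n ^ 3 := Nat.pow_le_pow_left hpow 3
  set L := Nat.log 2 n + 1
  set J := n / (160 * L)
  have hJ : 1 ≤ J := Nat.div_pos hn (by omega)
  have h3 : n < 320 * L * J := by
    have h := Nat.lt_mul_div_succ n (show 0 < 160 * L by omega)
    have h' : 160 * L ≤ 160 * L * J := Nat.le_mul_of_pos_right _ hJ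
    rw [mul_add, mul_one] at h
    change n < 160 * L * J + 160 * L at h
    linarith
  have h4 : n ^ 7 < (320 * L * J) ^ 7 := Nat.pow_lt_pow_left h3 (by norm_num)
  refine Nat.lt_of_mul_lt_mul_left (a := (320 * L) ^ 7) ?_
  rw [← mul_pow]
  refine lt_of_le_of_lt ?_ h4
  calc (320 * L) ^ 7 * (3 * n) ^ 4 = (81 * 320 ^ 7 * L ^ 7) * n ^ 4 := by ring
    _ ≤ n ^ 3 * n ^ 4 := by
        refine Nat.mul_le_mul_right _ (le_trans ?_ (h1.trans h2))
        exact Nat.mul_le_mul_right _ (by norm_num)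
    _ = n ^ 7 := by ring

end Growth

theorem stmt0 :
    ∃ C : ℝ, 0 < C ∧ ∀ t n : ℕ, 2 ≤ t → C * t * Real.log t ^ 2 ≤ n →
      ∀ 𝓕 : Finset (Finset (Finset (Fin n))),
        (∀ P ∈ 𝓕, IsPartition P) →
        (∀ P ∈ 𝓕, ∀ Q ∈ 𝓕, t ≤ (P ∩ Q).card) →
        𝓕.card ≤ bell (n - t) ∧
          (𝓕.card = bell (n - t) →
            ∃ S : Finset (Fin n), S.card = t ∧
              𝓕 = Finset.univ.filter fun P : Finset (Finset (Fin n)) =>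
                IsPartition P ∧ ∀ x ∈ S, {x} ∈ P) := by
  refine ⟨2 ^ 41, by positivity, fun t n ht hn 𝓕 hF hint => ?_⟩
  obtain ⟨hL, htL⟩ := mul_length_le ht hn
  set L := Nat.log 2 n + 1 with hLdef
  have hnL : n < 2 ^ L := Nat.lt_pow_succ_log_self (by norm_num) n
  have htL' : t ≤ t * L := Nat.le_mul_of_pos_right _ (by omega)
  have hLt : 2 * L ≤ t * L := Nat.mul_le_mul_right _ ht
  have hJt : 8 * t ≤ n / (160 * L) := by
    rw [Nat.le_div_iff_mul_le (by omega)]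
    linarith
  have hJL : 160 * (n / (160 * L) * L) ≤ n := by
    have := Nat.mul_div_le n (160 * L)
    linarith
  obtain ⟨h1, h2⟩ := card_le_bell (by omega)
    (sum_choose_mul_bell_lt ht (by omega) hnL hJL hJt)
    (choose_mul_bell_lt ht (by omega) hnL hJL hJt (pow_four_lt_div_pow hL (by omega))) hF hint
  refine ⟨h1, fun h => ?_⟩
  obtain ⟨T, hT, rfl⟩ := h2 h
  refine ⟨T, hT, ?_⟩
  ext P
  simp [mem_starFamily, subset_iff]
end

section
/- Let n, ℓ, t be positive integers such that t ≤ ℓ−2, n ≥ 2ℓ·log₂ n, and n ≥ 48. If 𝓕 is a t-intersecting family of partitions of [n] into exactly ℓ parts, then |𝓕| ≤ S(n−t, ℓ−t). Moreover, if 𝓕 is not contained in the family of all partitions of [n] into ℓ parts that contain t fixed singleton parts, then |𝓕| ≤ (1/2)·S(n−t, ℓ−t). -/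
open scoped Classical

/-- The Stirling number of the second kind `S(n,ℓ)`: the number of partitions of `[n]`
into exactly `ℓ` parts. -/
noncomputable def stirling (n ℓ : ℕ) : ℕ :=
  (Finset.univ.filter fun P : Finset (Finset (Fin n)) => IsPartition P ∧ P.card = ℓ).card

namespace Nat

theorem sum_stirlingSecond_mul_descFactorial (m k : ℕ) :
    ∑ j ∈ Finset.range (k + 1), stirlingSecond m j * k.descFactorial j = k ^ m := by
  induction m with
  | zero =>
    rw [Finset.sum_range_succ']
    simp
  | succ m ih =>
    have h₁ : ∑ j ∈ Finset.range k, (j + 1) * stirlingSecond m (j + 1) * k.descFactorial (j + 1) =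
        ∑ j ∈ Finset.range (k + 1), j * stirlingSecond m j * k.descFactorial j := by
      rw [Finset.sum_range_succ']
      simp
    have h₂ : ∑ j ∈ Finset.range k, stirlingSecond m j * k.descFactorial (j + 1) =
        ∑ j ∈ Finset.range (k + 1), (k - j) * stirlingSecond m j * k.descFactorial j := by
      rw [Finset.sum_range_succ]
      simp only [tsub_self, zero_mul, add_zero]
      refine Finset.sum_congr rfl fun j _ => ?_
      rw [descFactorial_succ]
      ring
    rw [Finset.sum_range_succ', stirlingSecond_succ_zero, zero_mul, add_zero]
    simp only [stirlingSecond_succ_succ, add_mul _ (stirlingSecond m _)]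
    rw [Finset.sum_add_distrib, h₁, h₂, ← Finset.sum_add_distrib, pow_succ', ← ih,
      Finset.mul_sum]
    refine Finset.sum_congr rfl fun j hj => ?_
    have hjk : j + (k - j) = k := by
      have := Finset.mem_range.mp hj
      omega
    rw [mul_assoc, mul_assoc, ← add_mul, hjk]

theorem factorial_mul_stirlingSecond_le_pow (m k : ℕ) : k ! * stirlingSecond m k ≤ k ^ m := by
  rw [← sum_stirlingSecond_mul_descFactorial m k, Finset.sum_range_succ, descFactorial_self]
  exact (mul_comm _ _).trans_le (Nat.le_add_left _ _)

theorem pow_le_factorial_mul_stirlingSecond_add (m k : ℕ) :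
    (k + 1) ^ m ≤ (k + 1)! * stirlingSecond m (k + 1) + (k + 1) * k ^ m := by
  rw [← sum_stirlingSecond_mul_descFactorial m (k + 1), Finset.sum_range_succ,
    descFactorial_self, add_comm, mul_comm,
    ← sum_stirlingSecond_mul_descFactorial m k, Finset.mul_sum]
  refine Nat.add_le_add_left (Finset.sum_le_sum fun j hj => ?_) _
  have hj : j ≤ k := by
    have := Finset.mem_range.mp hj
    omega
  have h := succ_descFactorial k j
  rw [mul_left_comm]
  gcongr
  rw [← h]
  exact le_mul_of_one_le_left (Nat.zero_le _) (by omega)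

theorem mul_stirlingSecond_le (m k : ℕ) :
    k * stirlingSecond m k ≤ stirlingSecond (m + 1) k := by
  cases k with
  | zero => simp
  | succ k => exact Nat.le_add_right _ _

theorem stirlingSecond_mono_left {k : ℕ} (hk : 1 ≤ k) :
    Monotone fun m => stirlingSecond m k :=
  monotone_nat_of_le_succ fun m =>
    (Nat.le_mul_of_pos_left _ hk).trans (mul_stirlingSecond_le m k)

theorem pow_le_stirlingSecond (j k : ℕ) : k ^ j ≤ stirlingSecond (k + j) k := by
  induction j with
  | zero => simp [stirlingSecond_self]
  | succ j ih =>
    rw [pow_succ']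
    exact (Nat.mul_le_mul_left k ih).trans (mul_stirlingSecond_le _ k)

theorem stirlingSecond_one_le (m : ℕ) : stirlingSecond m 1 ≤ 1 := by
  simpa using factorial_mul_stirlingSecond_le_pow m 1

theorem mul_stirlingSecond_le_succ_succ {c m k : ℕ} (h : (c + k) * k ^ m ≤ (k + 1) ^ m) :
    c * stirlingSecond m k ≤ stirlingSecond (m + 1) (k + 1) := by
  have h₁ := factorial_mul_stirlingSecond_le_pow m k
  have h₂ := pow_le_factorial_mul_stirlingSecond_add (m + 1) k
  have h₃ : c * k ^ m * (k + 1) ≤ (k + 1)! * stirlingSecond (m + 1) (k + 1) := by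
    rw [pow_succ, pow_succ k] at h₂
    have := Nat.mul_le_mul_right (k + 1) h
    nlinarith
  have h₄ := Nat.mul_le_mul_left (c * (k + 1)) h₁
  refine Nat.le_of_mul_le_mul_left ?_ (factorial_pos (k + 1))
  rw [factorial_succ] at h₃ ⊢
  nlinarith

theorem two_mul_pow_self_le_succ_pow_self {k : ℕ} (hk : 1 ≤ k) :
    2 * k ^ k ≤ (k + 1) ^ k := by
  obtain ⟨j, rfl⟩ := Nat.exists_eq_add_of_le' hk
  have h := pow_add_mul_le_add_pow_of_sq_nonneg (a := j + 1) (b := 1)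
    (by positivity) (by positivity) (by positivity) (by positivity) (j + 1)
  refine le_trans (le_of_eq ?_) h
  simp only [cast_id, add_tsub_cancel_right]
  ring

/-- `k ^ m` loses a factor `n ^ 2` against `(k + 1) ^ m` once `m / k ≥ n / ℓ ≥ 2 log₂ n`. -/
theorem sq_mul_pow_le_succ_pow {n ℓ m k : ℕ} (hℓ : 1 ≤ ℓ) (hk : 1 ≤ k)
    (hn : n ^ (2 * ℓ) ≤ 2 ^ n) (hm : k * n ≤ m * ℓ) :
    n ^ 2 * k ^ m ≤ (k + 1) ^ m := by
  rw [← Nat.pow_le_pow_iff_left (n := k * ℓ) (by positivity)]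
  calc (n ^ 2 * k ^ m) ^ (k * ℓ) = (n ^ (2 * ℓ)) ^ k * (k ^ k) ^ (m * ℓ) := by
        rw [mul_pow]; ring
    _ ≤ (2 ^ n) ^ k * (k ^ k) ^ (m * ℓ) := by gcongr
    _ = 2 ^ (k * n) * (k ^ k) ^ (m * ℓ) := by ring
    _ ≤ 2 ^ (m * ℓ) * (k ^ k) ^ (m * ℓ) := by gcongr; norm_num
    _ = (2 * k ^ k) ^ (m * ℓ) := by rw [mul_pow]
    _ ≤ ((k + 1) ^ k) ^ (m * ℓ) := by gcongr; exact two_mul_pow_self_le_succ_pow_self hk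
    _ = ((k + 1) ^ m) ^ (k * ℓ) := by ring

theorem two_mul_sq_mul_stirlingSecond_le {n ℓ t : ℕ} (ht : t + 2 ≤ ℓ) (hℓn : 2 * ℓ ≤ n)
    (hn : n ^ (2 * ℓ) ≤ 2 ^ n) :
    2 * ℓ ^ 2 * stirlingSecond (n - (t + 1)) (ℓ - (t + 1)) ≤ stirlingSecond (n - t) (ℓ - t) := by
  obtain ⟨k, rfl⟩ := Nat.exists_eq_add_of_le (show t + 1 ≤ ℓ by omega)
  obtain ⟨m, rfl⟩ := Nat.exists_eq_add_of_le (show t + 1 ≤ n by omega)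
  have hk : t + 1 + k - t = k + 1 := by omega
  have hm : t + 1 + m - t = m + 1 := by omega
  rw [hk, hm, Nat.add_sub_cancel_left, Nat.add_sub_cancel_left]
  refine mul_stirlingSecond_le_succ_succ ?_
  refine le_trans (Nat.mul_le_mul_right _ ?_)
    (sq_mul_pow_le_succ_pow (ℓ := t + 1 + k) (by omega) (by omega) hn ?_)
  · have : (2 * (t + 1 + k)) ^ 2 ≤ (t + 1 + m) ^ 2 := Nat.pow_le_pow_left hℓn 2
    nlinarith
  · have : k ≤ m := by omega
    nlinarith

theorem pow_mul_stirlingSecond_le {n ℓ t i : ℕ} (ht : t + i + 1 ≤ ℓ) (hℓn : 2 * ℓ ≤ n)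
    (hn : n ^ (2 * ℓ) ≤ 2 ^ n) :
    (2 * ℓ ^ 2) ^ i * stirlingSecond (n - (t + i)) (ℓ - (t + i)) ≤
      stirlingSecond (n - t) (ℓ - t) := by
  induction i with
  | zero => simp
  | succ i ih =>
    refine le_trans ?_ (ih (by omega))
    rw [pow_succ, mul_assoc]
    exact Nat.mul_le_mul_left _ (two_mul_sq_mul_stirlingSecond_le (by omega) hℓn hn)

theorem two_mul_pow_le_stirlingSecond {n ℓ t : ℕ} (ht : t + 2 ≤ ℓ) (hℓn : 2 * ℓ ≤ n)
    (hn : n ^ (2 * ℓ) ≤ 2 ^ n) :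
    2 * ℓ ^ (2 * ℓ) ≤ stirlingSecond (n - t) (ℓ - t) := by
  have h₁ : (ℓ - t) ^ (n - ℓ) ≤ stirlingSecond (n - t) (ℓ - t) := by
    convert pow_le_stirlingSecond (n - ℓ) (ℓ - t) using 2
    omega
  have h₂ : 2 ^ (n - ℓ) ≤ (ℓ - t) ^ (n - ℓ) := Nat.pow_le_pow_left (by omega) _
  refine le_trans ?_ (h₂.trans h₁)
  refine Nat.le_of_mul_le_mul_right ?_ (show 0 < 2 ^ ℓ by positivity)
  calc 2 * ℓ ^ (2 * ℓ) * 2 ^ ℓ = ℓ ^ (2 * ℓ) * 2 ^ (ℓ + 1) := by ring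
    _ ≤ ℓ ^ (2 * ℓ) * 2 ^ (2 * ℓ) := by
      gcongr
      · norm_num
      · omega
    _ = (2 * ℓ) ^ (2 * ℓ) := by rw [mul_pow, mul_comm]
    _ ≤ n ^ (2 * ℓ) := by gcongr
    _ ≤ 2 ^ n := hn
    _ = 2 ^ (n - ℓ) * 2 ^ ℓ := by
      rw [← pow_add]
      congr 1
      omega

end Nat

section Partitions

variable {α : Type*}

/-- `P` is a partition of the finite set `A` into nonempty parts. -/
def IsPartitionOf (A : Finset α) (P : Finset (Finset α)) : Prop :=
  ∅ ∉ P ∧ (∀ p ∈ P, ∀ q ∈ P, p ≠ q → Disjoint p q) ∧ ∀ x, x ∈ A ↔ ∃ p ∈ P, x ∈ p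

/-- The partitions of `A` into exactly `k` parts. -/
noncomputable def partitionsOf (A : Finset α) (k : ℕ) : Finset (Finset (Finset α)) :=
  A.powerset.powerset.filter fun P => IsPartitionOf A P ∧ P.card = k

theorem mem_partitionsOf {A : Finset α} {k : ℕ} {P : Finset (Finset α)} :
    P ∈ partitionsOf A k ↔ IsPartitionOf A P ∧ P.card = k := by
  simp only [partitionsOf, Finset.mem_filter, Finset.mem_powerset, and_iff_right_iff_imp]
  rintro ⟨h, -⟩ p hp
  exact Finset.mem_powerset.mpr fun x hx => (h.2.2 x).mpr ⟨p, hp, hx⟩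

theorem IsPartitionOf.subset {A p : Finset α} {P : Finset (Finset α)} (h : IsPartitionOf A P)
    (hp : p ∈ P) : p ⊆ A :=
  fun x hx => (h.2.2 x).mpr ⟨p, hp, hx⟩

theorem IsPartitionOf.eq_of_mem {A p q : Finset α} {P : Finset (Finset α)} {x : α}
    (h : IsPartitionOf A P) (hp : p ∈ P) (hq : q ∈ P) (hxp : x ∈ p) (hxq : x ∈ q) : p = q := by
  by_contra hne
  exact Finset.disjoint_left.mp (h.2.1 p hp q hq hne) hxp hxq

variable [DecidableEq α]

theorem IsPartitionOf.sdiff {A : Finset α} {P X : Finset (Finset α)} (h : IsPartitionOf A P)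
    (hX : X ⊆ P) : IsPartitionOf (A \ X.biUnion id) (P \ X) := by
  refine ⟨fun h' => h.1 (Finset.mem_sdiff.mp h').1, fun p hp q hq => h.2.1 p
    (Finset.mem_sdiff.mp hp).1 q (Finset.mem_sdiff.mp hq).1, fun x => ?_⟩
  simp only [Finset.mem_sdiff, Finset.mem_biUnion, id]
  constructor
  · rintro ⟨hx, hxX⟩
    obtain ⟨p, hp, hxp⟩ := (h.2.2 x).mp hx
    exact ⟨p, ⟨hp, fun hpX => hxX ⟨p, hpX, hxp⟩⟩, hxp⟩
  · rintro ⟨p, ⟨hp, hpX⟩, hxp⟩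
    refine ⟨h.subset hp hxp, ?_⟩
    rintro ⟨q, hq, hxq⟩
    exact hpX (h.eq_of_mem hp (hX hq) hxp hxq ▸ hq)

theorem IsPartitionOf.insert_singleton {A : Finset α} {Q : Finset (Finset α)} {a : α}
    (h : IsPartitionOf A Q) (ha : a ∉ A) : IsPartitionOf (insert a A) (insert {a} Q) := by
  have hd : ∀ q ∈ Q, a ∉ q := fun q hq haq => ha (h.subset hq haq)
  refine ⟨?_, ?_, fun x => ?_⟩
  · simp [h.1]
  · simp only [Finset.mem_insert]
    rintro p (rfl | hp) q (rfl | hq) hne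
    · exact absurd rfl hne
    · exact Finset.disjoint_singleton_left.mpr (hd q hq)
    · exact Finset.disjoint_singleton_right.mpr (hd p hp)
    · exact h.2.1 p hp q hq hne
  · simp [h.2.2 x]

theorem IsPartitionOf.insert_insert {A q : Finset α} {Q : Finset (Finset α)} {a : α}
    (h : IsPartitionOf A Q) (ha : a ∉ A) (hq : q ∈ Q) :
    IsPartitionOf (insert a A) (insert (insert a q) (Q.erase q)) := by
  have hd : ∀ q ∈ Q, a ∉ q := fun q hq haq => ha (h.subset hq haq)
  refine ⟨?_, ?_, fun x => ?_⟩
  · simp [h.1, (Finset.insert_ne_empty a q).symm]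
  · simp only [Finset.mem_insert, Finset.mem_erase]
    rintro r (rfl | ⟨hrq, hr⟩) s (rfl | ⟨hsq, hs⟩) hne
    · exact absurd rfl hne
    · exact Finset.disjoint_insert_left.mpr ⟨hd s hs, h.2.1 q hq s hs hsq.symm⟩
    · exact Finset.disjoint_insert_right.mpr ⟨hd r hr, h.2.1 r hr q hq hrq⟩
    · exact h.2.1 r hr s hs hne
  · simp only [Finset.mem_insert, h.2.2 x, Finset.mem_erase]
    constructor
    · rintro (rfl | ⟨p, hp, hxp⟩)
      · exact ⟨_, Or.inl rfl, Finset.mem_insert_self _ _⟩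
      · by_cases hpq : p = q
        · exact ⟨_, Or.inl rfl, Finset.mem_insert_of_mem (hpq ▸ hxp)⟩
        · exact ⟨p, Or.inr ⟨hpq, hp⟩, hxp⟩
    · rintro ⟨p, rfl | ⟨-, hp⟩, hxp⟩
      · exact (Finset.mem_insert.mp hxp).imp id fun hx => ⟨q, hq, hx⟩
      · exact Or.inr ⟨p, hp, hxp⟩

theorem IsPartitionOf.erase_of_mem {A p : Finset α} {P : Finset (Finset α)} {a : α}
    (h : IsPartitionOf (insert a A) P) (ha : a ∉ A) (hp : p ∈ P) (hap : a ∈ p) (hpa : p ≠ {a}) :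
    IsPartitionOf A (insert (p.erase a) (P.erase p)) := by
  have hd : ∀ q ∈ P, q ≠ p → a ∉ q := fun q hq hne haq => hne (h.eq_of_mem hq hp haq hap)
  refine ⟨?_, ?_, fun x => ?_⟩
  · simp only [Finset.mem_insert, Finset.mem_erase, not_or, not_and]
    refine ⟨fun h' => ?_, fun _ => h.1⟩
    rcases (Finset.erase_eq_empty_iff p a).mp h'.symm with h' | h'
    · exact h.1 (h' ▸ hp)
    · exact hpa h'
  · have hp' : p.erase a ⊆ p := Finset.erase_subset _ _
    simp only [Finset.mem_insert, Finset.mem_erase]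
    rintro r (rfl | ⟨hrp, hr⟩) s (rfl | ⟨hsp, hs⟩) hne
    · exact absurd rfl hne
    · exact (h.2.1 p hp s hs hsp.symm).mono_left hp'
    · exact (h.2.1 r hr p hp hrp).mono_right hp'
    · exact h.2.1 r hr s hs hne
  · simp only [Finset.mem_insert, Finset.mem_erase]
    constructor
    · intro hx
      have hxa : x ≠ a := fun hxa => ha (hxa ▸ hx)
      obtain ⟨q, hq, hxq⟩ := (h.2.2 x).mp (Finset.mem_insert_of_mem hx)
      by_cases hqp : q = p
      · exact ⟨_, Or.inl rfl, Finset.mem_erase.mpr ⟨hxa, hqp ▸ hxq⟩⟩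
      · exact ⟨q, Or.inr ⟨hqp, hq⟩, hxq⟩
    · rintro ⟨q, rfl | ⟨hqp, hq⟩, hxq⟩
      · obtain ⟨hxa, hxp⟩ := Finset.mem_erase.mp hxq
        exact (Finset.mem_insert.mp (h.subset hp hxp)).resolve_left hxa
      · refine (Finset.mem_insert.mp (h.subset hq hxq)).resolve_left ?_
        rintro rfl
        exact hd q hq hqp hxq

theorem card_partitionsOf_singleton_mem {A : Finset α} {a : α} (ha : a ∉ A) (k : ℕ) :
    ((partitionsOf (insert a A) (k + 1)).filter fun P => {a} ∈ P).card =
      (partitionsOf A k).card := by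
  symm
  refine Finset.card_bij' (fun Q _ => insert {a} Q) (fun P _ => P.erase {a}) ?_ ?_ ?_ ?_
  · intro Q hQ
    obtain ⟨hQ, hk⟩ := mem_partitionsOf.mp hQ
    have haQ : {a} ∉ Q := fun h' => ha (hQ.subset h' (Finset.mem_singleton_self a))
    simp [mem_partitionsOf, hQ.insert_singleton ha, haQ, hk]
  · intro P hP
    obtain ⟨hP, haP⟩ := Finset.mem_filter.mp hP
    obtain ⟨hP, hk⟩ := mem_partitionsOf.mp hP
    refine mem_partitionsOf.mpr ⟨?_, by rw [Finset.card_erase_of_mem haP, hk]; rfl⟩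
    have h := hP.sdiff (Finset.singleton_subset_iff.mpr haP)
    rwa [Finset.sdiff_singleton_eq_erase, Finset.singleton_biUnion, id,
      Finset.sdiff_singleton_eq_erase, Finset.erase_insert ha] at h
  · intro Q hQ
    obtain ⟨hQ, -⟩ := mem_partitionsOf.mp hQ
    exact Finset.erase_insert fun h' => ha (hQ.subset h' (Finset.mem_singleton_self a))
  · intro P hP
    exact Finset.insert_erase (Finset.mem_filter.mp hP).2

theorem card_partitionsOf_singleton_notMem {A : Finset α} {a : α} (ha : a ∉ A) (k : ℕ) :
    ((partitionsOf (insert a A) k).filter fun P => {a} ∉ P).card =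
      k * (partitionsOf A k).card := by
  have hcard : ((partitionsOf A k).sigma fun Q => Q).card = k * (partitionsOf A k).card := by
    rw [Finset.card_sigma, Finset.sum_congr rfl fun Q hQ => (mem_partitionsOf.mp hQ).2,
      Finset.sum_const, smul_eq_mul, mul_comm]
  rw [← hcard]
  symm
  refine Finset.card_bij (fun x _ => insert (insert a x.2) (x.1.erase x.2)) ?_ ?_ ?_
  · rintro ⟨Q, q⟩ hx
    obtain ⟨hQ, hq⟩ := Finset.mem_sigma.mp hx
    obtain ⟨hQ, hk⟩ := mem_partitionsOf.mp hQ
    have haQ : ∀ r ∈ Q, a ∉ r := fun r hr har => ha (hQ.subset hr har)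
    refine Finset.mem_filter.mpr ⟨mem_partitionsOf.mpr ⟨hQ.insert_insert ha hq, ?_⟩, ?_⟩
    · rw [Finset.card_insert_of_notMem, Finset.card_erase_add_one hq, hk]
      exact fun h' => haQ _ (Finset.mem_of_mem_erase h') (Finset.mem_insert_self _ _)
    · simp only [Finset.mem_insert, Finset.mem_erase, not_or, not_and]
      refine ⟨fun h' => hQ.1 ?_, fun _ h' => haQ _ h' (Finset.mem_singleton_self a)⟩
      have hqe : q = ∅ := by
        rw [← Finset.erase_insert (haQ q hq), ← h', Finset.erase_singleton]
      exact hqe ▸ hq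
  · rintro ⟨Q, q⟩ hx ⟨R, r⟩ hy heq
    obtain ⟨hQ, hq⟩ := Finset.mem_sigma.mp hx
    obtain ⟨hR, hr⟩ := Finset.mem_sigma.mp hy
    obtain ⟨hQ, -⟩ := mem_partitionsOf.mp hQ
    obtain ⟨hR, -⟩ := mem_partitionsOf.mp hR
    have haQ : ∀ s ∈ Q, a ∉ s := fun s hs has => ha (hQ.subset hs has)
    have haR : ∀ s ∈ R, a ∉ s := fun s hs has => ha (hR.subset hs has)
    dsimp only at heq hq hr
    have hmem : insert a q ∈ insert (insert a r) (R.erase r) :=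
      heq ▸ Finset.mem_insert_self _ _
    have hqr : insert a q = insert a r := (Finset.mem_insert.mp hmem).resolve_right fun h' =>
      haR _ (Finset.mem_of_mem_erase h') (Finset.mem_insert_self _ _)
    obtain rfl : q = r := by
      rw [← Finset.erase_insert (haQ q hq), hqr, Finset.erase_insert (haR r hr)]
    have herase : Q.erase q = R.erase q := by
      rw [← Finset.erase_insert (s := Q.erase q) (a := insert a q), heq, Finset.erase_insert]
      · exact fun h' => haR _ (Finset.mem_of_mem_erase h') (Finset.mem_insert_self _ _)
      · exact fun h' => haQ _ (Finset.mem_of_mem_erase h') (Finset.mem_insert_self _ _)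
    obtain rfl : Q = R := by
      rw [← Finset.insert_erase hq, herase, Finset.insert_erase hr]
    rfl
  · intro P hP
    obtain ⟨hP, haP⟩ := Finset.mem_filter.mp hP
    obtain ⟨hP, hk⟩ := mem_partitionsOf.mp hP
    obtain ⟨p, hp, hap⟩ := (hP.2.2 a).mp (Finset.mem_insert_self a A)
    have hpa : p ≠ {a} := fun h' => haP (h' ▸ hp)
    have hQ := hP.erase_of_mem ha hp hap hpa
    have hne : p.erase a ∉ P.erase p := by
      intro h'
      obtain ⟨hne, h'⟩ := Finset.mem_erase.mp h'
      obtain ⟨x, hx⟩ := Finset.nonempty_iff_ne_empty.mpr fun h0 => hP.1 (h0 ▸ h')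
      exact hne (hP.eq_of_mem h' hp hx (Finset.mem_of_mem_erase hx))
    refine ⟨⟨insert (p.erase a) (P.erase p), p.erase a⟩, Finset.mem_sigma.mpr
      ⟨mem_partitionsOf.mpr ⟨hQ, ?_⟩, Finset.mem_insert_self _ _⟩, ?_⟩
    · rw [Finset.card_insert_of_notMem hne, Finset.card_erase_add_one hp, hk]
    · dsimp only
      rw [Finset.erase_insert hne, Finset.insert_erase hap, Finset.insert_erase hp]

theorem card_partitionsOf (A : Finset α) (k : ℕ) :
    (partitionsOf A k).card = Nat.stirlingSecond A.card k := by
  induction A using Finset.induction_on generalizing k with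
  | empty =>
    have h : ∀ P, IsPartitionOf (∅ : Finset α) P ↔ P = ∅ := by
      intro P
      constructor
      · intro h
        refine Finset.eq_empty_of_forall_notMem fun p hp => h.1 ?_
        rwa [← Finset.subset_empty.mp (h.subset hp)]
      · rintro rfl
        simp [IsPartitionOf]
    cases k with
    | zero =>
      rw [Finset.card_empty, Nat.stirlingSecond_zero, Finset.card_eq_one]
      refine ⟨∅, Finset.ext fun P => ?_⟩
      rw [mem_partitionsOf, h, Finset.mem_singleton, and_iff_left_iff_imp]
      rintro rfl
      rfl
    | succ k =>
      rw [Finset.card_empty, Nat.stirlingSecond_zero_succ, Finset.card_eq_zero]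
      refine Finset.eq_empty_of_forall_notMem fun P hP => ?_
      obtain ⟨hP, hk⟩ := mem_partitionsOf.mp hP
      rw [(h P).mp hP] at hk
      simp at hk
  | insert a A ha ih =>
    rw [Finset.card_insert_of_notMem ha]
    cases k with
    | zero =>
      rw [Nat.stirlingSecond_succ_zero, Finset.card_eq_zero]
      refine Finset.eq_empty_of_forall_notMem fun P hP => ?_
      obtain ⟨hP, hk⟩ := mem_partitionsOf.mp hP
      obtain ⟨p, hp, -⟩ := (hP.2.2 a).mp (Finset.mem_insert_self a A)
      exact Finset.notMem_empty p (Finset.card_eq_zero.mp hk ▸ hp)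
    | succ k =>
      rw [Nat.stirlingSecond_succ_succ, ← ih, ← ih, ← card_partitionsOf_singleton_notMem ha,
        ← card_partitionsOf_singleton_mem ha,
        add_comm (Finset.card _), Finset.card_filter_add_card_filter_not]

theorem card_le_stirlingSecond_of_forall_subset {A : Finset α} {k : ℕ}
    {𝓕 : Finset (Finset (Finset α))} {X : Finset (Finset α)}
    (h𝓕 : ∀ P ∈ 𝓕, IsPartitionOf A P ∧ P.card = k) (hX : ∀ P ∈ 𝓕, X ⊆ P)
    (hXA : X.biUnion id ⊆ A) :
    𝓕.card ≤ Nat.stirlingSecond (A.card - (X.biUnion id).card) (k - X.card) := by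
  rw [← Finset.card_sdiff_of_subset hXA, ← card_partitionsOf]
  refine Finset.card_le_card_of_injOn (fun P => P \ X) (fun P hP => ?_) fun P hP Q hQ heq => ?_
  · obtain ⟨hP', hk⟩ := h𝓕 P hP
    refine mem_partitionsOf.mpr ⟨hP'.sdiff (hX P hP), ?_⟩
    rw [Finset.card_sdiff_of_subset (hX P hP), hk]
  · dsimp only at heq
    rw [← Finset.sdiff_union_of_subset (hX P hP), heq, Finset.sdiff_union_of_subset (hX Q hQ)]

theorem IsPartitionOf.card_le_card_biUnion {A : Finset α} {P X : Finset (Finset α)}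
    (h : IsPartitionOf A P) (hX : X ⊆ P) : X.card ≤ (X.biUnion id).card := by
  rw [Finset.card_biUnion (t := id) fun p hp q hq => h.2.1 p (hX hp) q (hX hq),
    Finset.card_eq_sum_ones]
  refine Finset.sum_le_sum fun p hp => Finset.card_pos.mpr ?_
  exact Finset.nonempty_iff_ne_empty.mpr fun h0 => h.1 (h0 ▸ hX hp)

theorem IsPartitionOf.eq_singleton_of_card_biUnion {A : Finset α} {P X : Finset (Finset α)}
    (h : IsPartitionOf A P) (hX : X ⊆ P) (hcard : (X.biUnion id).card = X.card) :
    ∀ x ∈ X.biUnion id, {x} ∈ X := by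
  rw [Finset.card_biUnion (t := id) fun p hp q hq => h.2.1 p (hX hp) q (hX hq),
    Finset.card_eq_sum_ones]
    at hcard
  have hle : ∀ p ∈ X, 1 ≤ (id p).card := fun p hp => Finset.card_pos.mpr <|
    Finset.nonempty_iff_ne_empty.mpr fun h0 => h.1 (h0 ▸ hX hp)
  intro x hx
  obtain ⟨p, hp, hxp⟩ := Finset.mem_biUnion.mp hx
  obtain ⟨y, hy⟩ := Finset.card_eq_one.mp
    ((Finset.sum_eq_sum_iff_of_le hle).mp hcard.symm p hp).symm
  rw [id] at hy hxp
  rw [hy, Finset.mem_singleton] at hxp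
  rwa [hxp, ← hy]

end Partitions

section Covers

variable {β : Type*} [DecidableEq β]

/-- If no set of size less than `b` meets every member of `𝓕` in at least `t` elements, then the
members of `𝓕` above `X` are covered by at most `ℓ ^ (b - |X|)` stars of sets of size `b`. -/
theorem card_filter_superset_le {𝓕 : Finset (Finset β)} {ℓ t b M : ℕ}
    (hℓ : ∀ P ∈ 𝓕, P.card ≤ ℓ)
    (hb : ∀ Y : Finset β, Y.card < b → ∃ Q ∈ 𝓕, (Y ∩ Q).card < t)
    (hint : ∀ P ∈ 𝓕, ∀ Q ∈ 𝓕, t ≤ (P ∩ Q).card)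
    (hM : ∀ Y : Finset β, Y.card = b → (𝓕.filter (Y ⊆ ·)).card ≤ M)
    (j : ℕ) (X : Finset β) (hX : X.card + j = b) :
    (𝓕.filter (X ⊆ ·)).card ≤ ℓ ^ j * M := by
  induction j generalizing X with
  | zero => simpa using hM X hX
  | succ j ih =>
    obtain ⟨Q, hQ, hQt⟩ := hb X (by omega)
    have hsub : 𝓕.filter (X ⊆ ·) ⊆
        (Q \ X).biUnion fun x => 𝓕.filter (insert x X ⊆ ·) := by
      intro R hR
      obtain ⟨hR, hXR⟩ := Finset.mem_filter.mp hR
      obtain ⟨x, hx, hxX⟩ := Finset.exists_mem_notMem_of_card_lt_card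
        (hQt.trans_le (hint R hR Q hQ))
      obtain ⟨hxR, hxQ⟩ := Finset.mem_inter.mp hx
      have hxX : x ∉ X := fun h => hxX (Finset.mem_inter.mpr ⟨h, hxQ⟩)
      exact Finset.mem_biUnion.mpr ⟨x, Finset.mem_sdiff.mpr ⟨hxQ, hxX⟩,
        Finset.mem_filter.mpr ⟨hR, Finset.insert_subset hxR hXR⟩⟩
    calc (𝓕.filter (X ⊆ ·)).card ≤ _ := Finset.card_le_card hsub
      _ ≤ (Q \ X).card * (ℓ ^ j * M) := by
        refine Finset.card_biUnion_le_card_mul _ _ _ fun x hx => ih _ ?_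
        rw [Finset.card_insert_of_notMem (Finset.mem_sdiff.mp hx).2]
        omega
      _ ≤ ℓ * (ℓ ^ j * M) := by
        gcongr
        exact (Finset.card_le_card Finset.sdiff_subset).trans (hℓ Q hQ)
      _ = ℓ ^ (j + 1) * M := by ring

theorem card_le_choose_mul_pow_mul {𝓕 : Finset (Finset β)} {ℓ t b M : ℕ} {T : Finset β}
    (hℓ : ∀ P ∈ 𝓕, P.card ≤ ℓ) (htb : t ≤ b)
    (hT : ∀ P ∈ 𝓕, t ≤ (T ∩ P).card)
    (hb : ∀ Y : Finset β, Y.card < b → ∃ Q ∈ 𝓕, (Y ∩ Q).card < t)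
    (hint : ∀ P ∈ 𝓕, ∀ Q ∈ 𝓕, t ≤ (P ∩ Q).card)
    (hM : ∀ Y : Finset β, Y.card = b → (𝓕.filter (Y ⊆ ·)).card ≤ M) :
    𝓕.card ≤ T.card.choose t * (ℓ ^ (b - t) * M) := by
  have hsub : 𝓕 ⊆ (T.powersetCard t).biUnion fun X => 𝓕.filter (X ⊆ ·) := by
    intro R hR
    obtain ⟨X, hXT, hX⟩ := Finset.exists_subset_card_eq (hT R hR)
    exact Finset.mem_biUnion.mpr ⟨X, Finset.mem_powersetCard.mpr
      ⟨hXT.trans Finset.inter_subset_left, hX⟩,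
      Finset.mem_filter.mpr ⟨hR, hXT.trans Finset.inter_subset_right⟩⟩
  calc 𝓕.card ≤ _ := Finset.card_le_card hsub
    _ ≤ (T.powersetCard t).card * (ℓ ^ (b - t) * M) := by
      refine Finset.card_biUnion_le_card_mul _ _ _ fun X hX => ?_
      have := (Finset.mem_powersetCard.mp hX).2
      exact card_filter_superset_le hℓ hb hint hM _ _ (by omega)
    _ = _ := by rw [Finset.card_powersetCard]

end Covers

section Main

variable {α : Type*} [DecidableEq α]

theorem card_filter_superset_le_stirlingSecond {A : Finset α} {ℓ : ℕ}
    {𝓕 : Finset (Finset (Finset α))} (h𝓕 : ∀ P ∈ 𝓕, IsPartitionOf A P ∧ P.card = ℓ)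
    {Y : Finset (Finset α)} (hY : Y.card + 1 ≤ ℓ) :
    (𝓕.filter (Y ⊆ ·)).card ≤ Nat.stirlingSecond (A.card - Y.card) (ℓ - Y.card) := by
  rcases (𝓕.filter (Y ⊆ ·)).eq_empty_or_nonempty with h | ⟨P, hP⟩
  · simp [h]
  obtain ⟨hP, hYP⟩ := Finset.mem_filter.mp hP
  obtain ⟨hP, -⟩ := h𝓕 P hP
  refine (card_le_stirlingSecond_of_forall_subset
    (fun Q hQ => h𝓕 Q (Finset.mem_of_mem_filter Q hQ))
    (fun Q hQ => (Finset.mem_filter.mp hQ).2)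
    (Finset.biUnion_subset.mpr fun p hp => hP.subset (hYP hp))).trans ?_
  have := hP.card_le_card_biUnion hYP
  exact Nat.stirlingSecond_mono_left (by omega) (by omega)

/-- A `t`-intersecting family of partitions without `t` common parts is small: branch from a
smallest set of parts that meets every member in at least `t` parts. -/
theorem two_mul_card_le_of_forall_exists_not_subset {A : Finset α} {ℓ t : ℕ}
    {𝓕 : Finset (Finset (Finset α))} (ht : t + 2 ≤ ℓ) (hℓA : 2 * ℓ ≤ A.card)
    (hA : A.card ^ (2 * ℓ) ≤ 2 ^ A.card)
    (h𝓕 : ∀ P ∈ 𝓕, IsPartitionOf A P ∧ P.card = ℓ)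
    (hint : ∀ P ∈ 𝓕, ∀ Q ∈ 𝓕, t ≤ (P ∩ Q).card)
    (hnt : ∀ Y : Finset (Finset α), Y.card = t → ∃ P ∈ 𝓕, ¬Y ⊆ P) :
    2 * 𝓕.card ≤ Nat.stirlingSecond (A.card - t) (ℓ - t) := by
  rcases 𝓕.eq_empty_or_nonempty with rfl | ⟨P₀, hP₀⟩
  · simp
  have hex : ∃ s, ∃ T : Finset (Finset α), T.card = s ∧ ∀ P ∈ 𝓕, t ≤ (T ∩ P).card :=
    ⟨_, P₀, rfl, hint P₀ hP₀⟩
  obtain ⟨T, hTs, hT⟩ := Nat.find_spec hex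
  have hmin : ∀ Y : Finset (Finset α), Y.card < T.card → ∃ Q ∈ 𝓕, (Y ∩ Q).card < t := by
    intro Y hY
    by_contra! h
    exact Nat.find_min hex (hTs ▸ hY) ⟨Y, rfl, h⟩
  have hTℓ : T.card ≤ ℓ := by
    rw [hTs, ← (h𝓕 P₀ hP₀).2]
    exact Nat.find_min' hex ⟨P₀, rfl, hint P₀ hP₀⟩
  have htT : t < T.card := by
    refine lt_of_le_of_ne ((hT P₀ hP₀).trans (Finset.card_le_card Finset.inter_subset_left))
      fun heq => ?_
    obtain ⟨P, hP, hTP⟩ := hnt T heq.symm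
    exact hTP (Finset.inter_eq_left.mp
      (Finset.eq_of_subset_of_card_le Finset.inter_subset_left (heq ▸ hT P hP)))
  have hcard : ∀ P ∈ 𝓕, P.card ≤ ℓ := fun P hP => (h𝓕 P hP).2.le
  have hchoose : T.card.choose t ≤ ℓ ^ (T.card - t) := by
    rw [← Nat.choose_symm htT.le]
    exact (Nat.choose_le_pow _ _).trans (Nat.pow_le_pow_left hTℓ _)
  rcases hTℓ.lt_or_eq with hlt | heq
  · obtain ⟨i, hi⟩ := Nat.exists_eq_add_of_le htT.le
    have hM : ∀ Y : Finset (Finset α), Y.card = T.card → (𝓕.filter (Y ⊆ ·)).card ≤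
        Nat.stirlingSecond (A.card - (t + i)) (ℓ - (t + i)) := by
      intro Y hY
      rw [← hi, ← hY]
      exact card_filter_superset_le_stirlingSecond h𝓕 (by omega)
    have h := card_le_choose_mul_pow_mul hcard htT.le hT hmin hint hM
    rw [hi, Nat.add_sub_cancel_left] at h hchoose
    calc 2 * 𝓕.card ≤ 2 * (ℓ ^ i * (ℓ ^ i *
          Nat.stirlingSecond (A.card - (t + i)) (ℓ - (t + i)))) := by
          refine Nat.mul_le_mul_left 2 (h.trans ?_)
          gcongr
      _ = 2 * (ℓ ^ 2) ^ i * Nat.stirlingSecond (A.card - (t + i)) (ℓ - (t + i)) := by ring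
      _ ≤ (2 * ℓ ^ 2) ^ i * Nat.stirlingSecond (A.card - (t + i)) (ℓ - (t + i)) := by
        rw [mul_pow 2]
        gcongr
        exact Nat.le_self_pow (by omega) 2
      _ ≤ _ := Nat.pow_mul_stirlingSecond_le (by omega) hℓA hA
  · have hM : ∀ Y : Finset (Finset α), Y.card = ℓ - 1 → (𝓕.filter (Y ⊆ ·)).card ≤ 1 := by
      intro Y hY
      refine (card_filter_superset_le_stirlingSecond h𝓕 (by omega)).trans ?_
      rw [show ℓ - Y.card = 1 by omega]
      exact Nat.stirlingSecond_one_le _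
    have h := card_le_choose_mul_pow_mul hcard (by omega) hT
      (fun Y hY => hmin Y (by omega)) hint hM
    calc 2 * 𝓕.card ≤ 2 * (ℓ ^ (T.card - t) * (ℓ ^ (ℓ - 1 - t) * 1)) := by
          refine Nat.mul_le_mul_left 2 (h.trans ?_)
          gcongr
      _ = 2 * ℓ ^ (T.card - t + (ℓ - 1 - t)) := by ring
      _ ≤ 2 * ℓ ^ (2 * ℓ) := by
        gcongr
        · omega
        · omega
      _ ≤ _ := Nat.two_mul_pow_le_stirlingSecond ht hℓA hA

/-- A family of partitions with common parts `Y`, not all singletons. -/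
theorem two_mul_card_le_of_forall_subset {A : Finset α} {ℓ t : ℕ}
    {𝓕 : Finset (Finset (Finset α))} (ht : t + 2 ≤ ℓ)
    (h𝓕 : ∀ P ∈ 𝓕, IsPartitionOf A P ∧ P.card = ℓ)
    {Y : Finset (Finset α)} (hY : Y.card = t) (hYF : ∀ P ∈ 𝓕, Y ⊆ P)
    (hns : ¬∃ S : Finset α, S.card = t ∧ ∀ P ∈ 𝓕, ∀ x ∈ S, {x} ∈ P) :
    2 * 𝓕.card ≤ Nat.stirlingSecond (A.card - t) (ℓ - t) := by
  rcases 𝓕.eq_empty_or_nonempty with rfl | ⟨P, hP⟩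
  · simp
  obtain ⟨hP', hPℓ⟩ := h𝓕 P hP
  have hYP := hYF P hP
  have hYA : Y.biUnion id ⊆ A := Finset.biUnion_subset.mpr fun p hp => hP'.subset (hYP hp)
  have hlt : t < (Y.biUnion id).card := by
    refine lt_of_le_of_ne (hY ▸ hP'.card_le_card_biUnion hYP) fun heq => hns ⟨_, heq.symm, ?_⟩
    intro Q hQ x hx
    exact hYF Q hQ (hP'.eq_singleton_of_card_biUnion hYP (heq.symm.trans hY.symm) x hx)
  have hle := Finset.card_le_card hYA
  calc 2 * 𝓕.card ≤ (ℓ - t) * Nat.stirlingSecond (A.card - t - 1) (ℓ - t) := by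
        refine Nat.mul_le_mul (by omega)
          ((card_le_stirlingSecond_of_forall_subset h𝓕 hYF hYA).trans ?_)
        rw [hY]
        exact Nat.stirlingSecond_mono_left (by omega) (by omega)
    _ ≤ Nat.stirlingSecond (A.card - t - 1 + 1) (ℓ - t) := Nat.mul_stirlingSecond_le _ _
    _ = _ := by rw [Nat.sub_add_cancel (by omega)]

end Main

theorem isPartition_iff_isPartitionOf_univ {n : ℕ} {P : Finset (Finset (Fin n))} :
    IsPartition P ↔ IsPartitionOf Finset.univ P := by
  simp [IsPartition, IsPartitionOf]

theorem stirling_eq_stirlingSecond (n ℓ : ℕ) : stirling n ℓ = Nat.stirlingSecond n ℓ := by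
  rw [← Finset.card_fin n, ← card_partitionsOf, Finset.card_fin, stirling]
  congr 1
  ext P
  simp [mem_partitionsOf, isPartition_iff_isPartitionOf_univ]

theorem pow_le_two_pow_of_mul_logb_le {n k : ℕ} (hn : 0 < n) (h : (k : ℝ) * Real.logb 2 n ≤ n) :
    n ^ k ≤ 2 ^ n := by
  have hn' : (0 : ℝ) < n := Nat.cast_pos.mpr hn
  have h' : Real.logb 2 ((n : ℝ) ^ k) ≤ n := by rwa [Real.logb_pow]
  rw [Real.logb_le_iff_le_rpow (by norm_num) (by positivity), Real.rpow_natCast] at h'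
  exact_mod_cast h'

theorem stmt1 (n ℓ t : ℕ) (hn : 1 ≤ n) (hℓ : 1 ≤ ℓ) (ht : 1 ≤ t)
    (htℓ : t + 2 ≤ ℓ) (hlog : 2 * (ℓ : ℝ) * Real.logb 2 n ≤ n) (hn48 : 48 ≤ n)
    (𝓕 : Finset (Finset (Finset (Fin n))))
    (h𝓕 : ∀ P ∈ 𝓕, IsPartition P ∧ P.card = ℓ)
    (hint : ∀ P ∈ 𝓕, ∀ Q ∈ 𝓕, t ≤ (P ∩ Q).card) :
    𝓕.card ≤ stirling (n - t) (ℓ - t) ∧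
      (¬(∃ S : Finset (Fin n), S.card = t ∧ ∀ P ∈ 𝓕, ∀ x ∈ S, {x} ∈ P) →
        2 * 𝓕.card ≤ stirling (n - t) (ℓ - t)) := by
  rw [stirling_eq_stirlingSecond]
  have hpow : n ^ (2 * ℓ) ≤ 2 ^ n := pow_le_two_pow_of_mul_logb_le hn (by exact_mod_cast hlog)
  have hℓn : 2 * ℓ ≤ n := (Nat.pow_le_pow_iff_right (a := 2) (by norm_num)).mp
    ((Nat.pow_le_pow_left (by omega) _).trans hpow)
  have h𝓕' : ∀ P ∈ 𝓕, IsPartitionOf Finset.univ P ∧ P.card = ℓ := fun P hP =>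
    (h𝓕 P hP).imp_left isPartition_iff_isPartitionOf_univ.mp
  have hns : ¬(∃ S : Finset (Fin n), S.card = t ∧ ∀ P ∈ 𝓕, ∀ x ∈ S, {x} ∈ P) →
      2 * 𝓕.card ≤ Nat.stirlingSecond (n - t) (ℓ - t) := by
    intro hns
    by_cases hY : ∃ Y : Finset (Finset (Fin n)), Y.card = t ∧ ∀ P ∈ 𝓕, Y ⊆ P
    · obtain ⟨Y, hY, hYF⟩ := hY
      simpa using two_mul_card_le_of_forall_subset htℓ h𝓕' hY hYF hns
    · push Not at hY
      simpa using two_mul_card_le_of_forall_exists_not_subset htℓ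
        (by rwa [Finset.card_fin]) (by rwa [Finset.card_fin]) h𝓕' hint hY
  refine ⟨?_, hns⟩
  by_cases hS : ∃ S : Finset (Fin n), S.card = t ∧ ∀ P ∈ 𝓕, ∀ x ∈ S, {x} ∈ P
  · obtain ⟨S, hSt, hS⟩ := hS
    have hY : (S.map ⟨fun x => ({x} : Finset (Fin n)), Finset.singleton_injective⟩).card = t := by
      rw [Finset.card_map, hSt]
    have h := card_filter_superset_le_stirlingSecond h𝓕' (by rw [hY]; omega)
    rw [Finset.filter_true_of_mem, hY, Finset.card_fin] at h
    · exact h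
    · intro P hP p hp
      obtain ⟨x, hx, rfl⟩ := Finset.mem_map.mp hp
      exact hS P hP x hx
  · have := hns hS
    omega
end
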